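/- Let $1 \le p \le 2$ and $p \le q \le p'$, and define $r$ by $\frac{1}{r} = \frac{1}{2}\big(1 - \frac{1}{p} + \frac{1}{q}\big)$. Then the Banach space $S_q(S_p)$ (the Schatten $q$-class with values in the Schatten $p$-class) has Rademacher cotype $r$, and $r$ is sharp: $S_q(S_p)$ fails cotype $s$ for every $s < r$. -/

import Mathlib

open scoped ENNReal BigOperators ComplexOrder Kronecker
open Matrix

noncomputable def ctmEig {m n : Type*} [Fintype m] [Fintype n] [DecidableEq n]
    (a : Matrix m n ℂ) : n → ℝ :=
  (Matrix.posSemidef_conjTranspose_mul_self a).isHermitian.eigenvalues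

/-- Schatten `p`-norm of a (rectangular) complex matrix; `p = ∞` is the operator norm. -/
noncomputable def schNorm {m n : Type*} [Fintype m] [Fintype n] [DecidableEq n]
    (p : ℝ≥0∞) (a : Matrix m n ℂ) : ℝ :=
  if p = ∞ then ⨆ j, Real.sqrt (ctmEig a j)
  else (∑ j, ctmEig a j ^ (p.toReal / 2)) ^ (1 / p.toReal)

/-- The norm of Pisier's vector-valued Schatten class `S_q^N(S_p^M)` for `p ≤ q`, via the
factorization/supremum formula
`‖x‖_{S_q(S_p)} = sup { ‖(a ⊗ 1) x (b ⊗ 1)‖_{S_p} : ‖a‖_{S_{2t}}, ‖b‖_{S_{2t}} ≤ 1 }`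
where `1/p = 1/q + 1/t` (so `2t = 2pq/(q-p)`, `= ∞` when `p = q`). -/
noncomputable def sqSpNorm (q p : ℝ) {N M : ℕ}
    (x : Matrix (Fin N × Fin M) (Fin N × Fin M) ℂ) : ℝ :=
  sSup {c : ℝ | ∃ a b : Matrix (Fin N) (Fin N) ℂ,
    schNorm (if p = q then ∞ else ENNReal.ofReal (2 * p * q / (q - p))) a ≤ 1 ∧
    schNorm (if p = q then ∞ else ENNReal.ofReal (2 * p * q / (q - p))) b ≤ 1 ∧
    c = schNorm (ENNReal.ofReal p)
          ((a ⊗ₖ (1 : Matrix (Fin M) (Fin M) ℂ)) * x * (b ⊗ₖ (1 : Matrix (Fin M) (Fin M) ℂ)))}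

namespace SchattenCotype

section FunctionalCalculus

open scoped MatrixOrder

variable {m n : Type*} [Fintype m] [DecidableEq m] [Fintype n] [DecidableEq n]

/-- The functional calculus of a Hermitian matrix; every function is continuous on the spectrum. -/
noncomputable def fc (f : ℝ → ℝ) (A : Matrix n n ℂ) : Matrix n n ℂ := cfc f A

lemma continuousOn_spectrum (f : ℝ → ℝ) (A : Matrix n n ℂ) :
    ContinuousOn f (spectrum ℝ A) :=
  (Matrix.finite_real_spectrum (A := A)).continuousOn f

lemma isHermitian_fc (f : ℝ → ℝ) (A : Matrix n n ℂ) : (fc f A).IsHermitian :=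
  cfc_predicate (p := IsSelfAdjoint) f A

lemma fc_eq {A : Matrix n n ℂ} (hA : A.IsHermitian) (f : ℝ → ℝ) :
    fc f A = (hA.eigenvectorUnitary : Matrix n n ℂ) *
      diagonal (fun i => (f (hA.eigenvalues i) : ℂ)) * (hA.eigenvectorUnitary : Matrix n n ℂ)ᴴ := by
  rw [fc, hA.cfc_eq, IsHermitian.cfc, Unitary.conjStarAlgAut_apply]
  rfl

lemma fc_mul (f g : ℝ → ℝ) (A : Matrix n n ℂ) :
    fc f A * fc g A = fc (fun x => f x * g x) A :=
  (cfc_mul f g A (continuousOn_spectrum _ _) (continuousOn_spectrum _ _)).symm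

lemma fc_comp {A : Matrix n n ℂ} (hA : A.IsHermitian) (f g : ℝ → ℝ) :
    fc g (fc f A) = fc (fun x => g (f x)) A :=
  (cfc_comp g f A hA (((Matrix.finite_real_spectrum (A := A)).image f).continuousOn g)
    (continuousOn_spectrum _ _)).symm

lemma fc_id {A : Matrix n n ℂ} (hA : A.IsHermitian) : fc (fun x => x) A = A :=
  cfc_id' ℝ A hA

lemma fc_one {A : Matrix n n ℂ} (hA : A.IsHermitian) : fc (fun _ => 1) A = 1 :=
  cfc_const_one ℝ A hA

lemma fc_sub (f g : ℝ → ℝ) (A : Matrix n n ℂ) :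
    fc (fun x => f x - g x) A = fc f A - fc g A :=
  cfc_sub f g A (continuousOn_spectrum _ _) (continuousOn_spectrum _ _)

lemma fc_const_mul (c : ℝ) (f : ℝ → ℝ) (A : Matrix n n ℂ) :
    fc (fun x => c * f x) A = c • fc f A :=
  cfc_const_mul c f A (continuousOn_spectrum _ _)

lemma fc_congr {A : Matrix n n ℂ} (hA : A.IsHermitian) {f g : ℝ → ℝ}
    (h : ∀ i, f (hA.eigenvalues i) = g (hA.eigenvalues i)) : fc f A = fc g A := by
  simp only [fc_eq hA, h]

lemma fc_nonneg {A : Matrix n n ℂ} (hA : A.IsHermitian) {f : ℝ → ℝ}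
    (h : ∀ i, 0 ≤ f (hA.eigenvalues i)) : (fc f A).PosSemidef := by
  rw [fc_eq hA]
  refine PosSemidef.mul_mul_conjTranspose_same (PosSemidef.diagonal fun i => ?_) _
  exact Complex.zero_le_real.2 (h i)

lemma fc_mono {A : Matrix n n ℂ} (hA : A.IsHermitian) {f g : ℝ → ℝ}
    (h : ∀ i, f (hA.eigenvalues i) ≤ g (hA.eigenvalues i)) : fc f A ≤ fc g A := by
  rw [Matrix.le_iff, ← fc_sub]
  exact fc_nonneg hA fun i => sub_nonneg.2 (h i)

lemma fc_sq {A : Matrix n n ℂ} (hA : A.IsHermitian) : fc (fun x => x ^ 2) A = A * A := by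
  conv_rhs => rw [← fc_id hA, fc_mul]
  exact congrArg (fc · A) (by ext; ring)

lemma trace_fc {A : Matrix n n ℂ} (hA : A.IsHermitian) (f : ℝ → ℝ) :
    (fc f A).trace = ((∑ i, f (hA.eigenvalues i) : ℝ) : ℂ) := by
  rw [fc_eq hA, trace_mul_comm, ← mul_assoc, ← star_eq_conjTranspose,
    Unitary.coe_star_mul_self, one_mul, trace_diagonal]
  push_cast
  rfl

lemma re_trace_fc {A : Matrix n n ℂ} (hA : A.IsHermitian) (f : ℝ → ℝ) :
    (fc f A).trace.re = ∑ i, f (hA.eigenvalues i) := by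
  rw [trace_fc hA, Complex.ofReal_re]

/-- Squared moduli of the inner products of the eigenvectors of two Hermitian matrices. -/
noncomputable def overlap {A B : Matrix n n ℂ} (hA : A.IsHermitian) (hB : B.IsHermitian)
    (i j : n) : ℝ :=
  ‖((hA.eigenvectorUnitary : Matrix n n ℂ)ᴴ * (hB.eigenvectorUnitary : Matrix n n ℂ)) i j‖ ^ 2

lemma overlap_nonneg {A B : Matrix n n ℂ} (hA : A.IsHermitian) (hB : B.IsHermitian) (i j : n) :
    0 ≤ overlap hA hB i j := sq_nonneg _

lemma trace_diagonal_conj (W : Matrix n n ℂ) (d e : n → ℂ) :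
    (diagonal d * W * diagonal e * Wᴴ).trace =
      ∑ i, ∑ j, d i * e j * ((‖W i j‖ ^ 2 : ℝ) : ℂ) := by
  refine Finset.sum_congr rfl fun i _ => ?_
  rw [diag_apply, Matrix.mul_apply]
  refine Finset.sum_congr rfl fun j _ => ?_
  rw [mul_diagonal, diagonal_mul, conjTranspose_apply, Complex.ofReal_pow, ← Complex.mul_conj',
    ← Complex.star_def]
  ring

lemma trace_fc_mul_fc {A B : Matrix n n ℂ} (hA : A.IsHermitian) (hB : B.IsHermitian)
    (f g : ℝ → ℝ) :
    (fc f A * fc g B).trace.re =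
      ∑ i, ∑ j, f (hA.eigenvalues i) * g (hB.eigenvalues j) * overlap hA hB i j := by
  set U := (hA.eigenvectorUnitary : Matrix n n ℂ)
  set V := (hB.eigenvectorUnitary : Matrix n n ℂ)
  have : (fc f A * fc g B).trace = (diagonal (fun i => (f (hA.eigenvalues i) : ℂ)) * (Uᴴ * V) *
      diagonal (fun i => (g (hB.eigenvalues i) : ℂ)) * (Uᴴ * V)ᴴ).trace := by
    rw [fc_eq hA, fc_eq hB, conjTranspose_mul, conjTranspose_conjTranspose]
    rw [mul_assoc U, mul_assoc U, trace_mul_comm U]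
    simp only [mul_assoc]
    rfl
  rw [this, trace_diagonal_conj, ← Complex.ofReal_re (∑ i, ∑ j, _)]
  congr 1
  simp only [Complex.ofReal_sum, Complex.ofReal_mul]
  rfl

lemma sum_overlap_left {A B : Matrix n n ℂ} (hA : A.IsHermitian) (hB : B.IsHermitian) (j : n) :
    ∑ i, overlap hA hB i j = 1 := by
  set W := (hA.eigenvectorUnitary : Matrix n n ℂ)ᴴ * (hB.eigenvectorUnitary : Matrix n n ℂ)
    with hW
  have h : Wᴴ * W = 1 := by
    rw [hW, conjTranspose_mul, conjTranspose_conjTranspose, mul_assoc,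
      ← mul_assoc (hA.eigenvectorUnitary : Matrix n n ℂ), ← star_eq_conjTranspose,
      ← star_eq_conjTranspose, Unitary.mul_star_self_of_mem (SetLike.coe_mem _), one_mul,
      Unitary.star_mul_self_of_mem (SetLike.coe_mem _)]
  have h2 := congrFun (congrFun h j) j
  simp only [mul_apply, conjTranspose_apply, one_apply_eq] at h2
  apply Complex.ofReal_injective
  push_cast
  rw [← h2]
  refine Finset.sum_congr rfl fun i _ => ?_
  rw [overlap, Complex.ofReal_pow, ← Complex.conj_mul', ← Complex.star_def]

lemma overlap_comm {A B : Matrix n n ℂ} (hA : A.IsHermitian) (hB : B.IsHermitian) (i j : n) :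
    overlap hA hB i j = overlap hB hA j i := by
  have : (hB.eigenvectorUnitary : Matrix n n ℂ)ᴴ * (hA.eigenvectorUnitary : Matrix n n ℂ) =
    ((hA.eigenvectorUnitary : Matrix n n ℂ)ᴴ * (hB.eigenvectorUnitary : Matrix n n ℂ))ᴴ := by
    rw [conjTranspose_mul, conjTranspose_conjTranspose]
  rw [overlap, overlap, this, conjTranspose_apply, norm_star]

lemma sum_overlap_right {A B : Matrix n n ℂ} (hA : A.IsHermitian) (hB : B.IsHermitian) (i : n) :
    ∑ j, overlap hA hB i j = 1 := by
  simp only [overlap_comm hA hB]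
  exact sum_overlap_left hB hA i

/-- Eigenvalue sums depend on a Hermitian matrix only through its characteristic polynomial. -/
lemma trace_fc_eq_of_charpoly {A : Matrix n n ℂ} {B : Matrix n n ℂ} (hA : A.IsHermitian)
    (hB : B.IsHermitian) (h : A.charpoly = B.charpoly) (f : ℝ → ℝ) :
    ∑ i, f (hA.eigenvalues i) = ∑ i, f (hB.eigenvalues i) := by
  have h1 := hA.roots_charpoly_eq_eigenvalues
  rw [h, hB.roots_charpoly_eq_eigenvalues] at h1
  have h2 := congrArg (fun s : Multiset ℂ => (s.map fun z => f z.re).sum) h1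
  simpa using h2.symm

lemma re_trace_mul_nonneg {A B : Matrix n n ℂ} (hA : A.PosSemidef) (hB : B.PosSemidef) :
    0 ≤ (A * B).trace.re := by
  have := trace_fc_mul_fc hA.isHermitian hB.isHermitian (fun x => x) (fun x => x)
  rw [fc_id hA.isHermitian, fc_id hB.isHermitian] at this
  rw [this]
  exact Finset.sum_nonneg fun i _ => Finset.sum_nonneg fun j _ =>
    mul_nonneg (mul_nonneg (hA.eigenvalues_nonneg i) (hB.eigenvalues_nonneg j))
      (overlap_nonneg _ _ _ _)

lemma re_trace_mul_le {A A' B : Matrix n n ℂ} (hA : A ≤ A') (hB : B.PosSemidef) :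
    (A * B).trace.re ≤ (A' * B).trace.re := by
  have := re_trace_mul_nonneg (Matrix.le_iff.1 hA) hB
  rw [sub_mul, trace_sub, Complex.sub_re] at this
  linarith

lemma re_trace_le {A A' : Matrix n n ℂ} (hA : A ≤ A') : A.trace.re ≤ A'.trace.re := by
  simpa using re_trace_mul_le hA (PosSemidef.one (n := n) (R := ℂ))

omit [DecidableEq m] [DecidableEq n] in
lemma conj_le_conj {A B : Matrix n n ℂ} (h : A ≤ B) (C : Matrix n m ℂ) :
    Cᴴ * A * C ≤ Cᴴ * B * C := by
  rw [Matrix.le_iff, ← Matrix.sub_mul, ← Matrix.mul_sub]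
  exact (Matrix.le_iff.1 h).conjTranspose_mul_mul_same C

/-- Real powers of a positive semidefinite matrix. -/
noncomputable def mpow (A : Matrix n n ℂ) (s : ℝ) : Matrix n n ℂ := fc (fun t => t ^ s) A

lemma mpow_posSemidef {A : Matrix n n ℂ} (hA : A.PosSemidef) (s : ℝ) : (mpow A s).PosSemidef :=
  fc_nonneg hA.isHermitian fun i => Real.rpow_nonneg (hA.eigenvalues_nonneg i) s

lemma mpow_isHermitian (A : Matrix n n ℂ) (s : ℝ) : (mpow A s).IsHermitian := isHermitian_fc _ _

lemma mpow_zero {A : Matrix n n ℂ} (hA : A.IsHermitian) : mpow A 0 = 1 := by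
  simp only [mpow, Real.rpow_zero, fc_one hA]

lemma mpow_one {A : Matrix n n ℂ} (hA : A.IsHermitian) : mpow A 1 = A := by
  simp only [mpow, Real.rpow_one, fc_id hA]

lemma mpow_mul_mpow {A : Matrix n n ℂ} (hA : A.PosDef) (s t : ℝ) :
    mpow A s * mpow A t = mpow A (s + t) := by
  rw [mpow, mpow, fc_mul, mpow]
  exact fc_congr hA.isHermitian fun i => (Real.rpow_add (hA.eigenvalues_pos i) s t).symm

lemma mpow_mpow {A : Matrix n n ℂ} (hA : A.PosSemidef) (s t : ℝ) :
    mpow (mpow A s) t = mpow A (s * t) := by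
  rw [mpow, mpow, fc_comp hA.isHermitian, mpow]
  exact fc_congr hA.isHermitian fun i => (Real.rpow_mul (hA.eigenvalues_nonneg i) s t).symm

omit [Fintype n] [DecidableEq n] in
lemma smul_posSemidef {A : Matrix n n ℂ} (hA : A.PosSemidef) {c : ℝ} (hc : 0 ≤ c) :
    (c • A).PosSemidef := by
  have := hA.smul (a := (c : ℂ)) (by exact_mod_cast hc)
  simpa using this

lemma mpow_smul {A : Matrix n n ℂ} (hA : A.PosSemidef) {c : ℝ} (hc : 0 ≤ c) (s : ℝ) :
    mpow (c • A) s = c ^ s • mpow A s := by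
  have h : c • A = fc (fun x => c * x) A := by rw [fc_const_mul, fc_id hA.isHermitian]
  rw [h, mpow, fc_comp hA.isHermitian, mpow, ← fc_const_mul]
  exact fc_congr hA.isHermitian fun i => Real.mul_rpow hc (hA.eigenvalues_nonneg i)

end FunctionalCalculus

section OperatorMonotone

open scoped MatrixOrder Matrix.Norms.L2Operator

variable {n : Type*} [Fintype n] [DecidableEq n]

lemma rpow_eq_mpow {A : Matrix n n ℂ} (hA : A.PosSemidef) (s : ℝ) : A ^ s = mpow A s :=
  CFC.rpow_eq_cfc_real hA.nonneg

lemma mpow_le_mpow {A B : Matrix n n ℂ} (hA : A.PosSemidef) (h : A ≤ B) {s : ℝ} (hs : 0 ≤ s)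
    (hs1 : s ≤ 1) : mpow A s ≤ mpow B s := by
  have hB : B.PosSemidef := Matrix.nonneg_iff_posSemidef.1 (hA.nonneg.trans h)
  rw [← rpow_eq_mpow hA, ← rpow_eq_mpow hB]
  exact CFC.rpow_le_rpow ⟨hs, hs1⟩ h

lemma sum_smul_mpow_le {ι : Type*} {t : Finset ι} {w : ι → ℝ} {A : ι → Matrix n n ℂ}
    (hw : ∀ i ∈ t, 0 ≤ w i) (hw1 : ∑ i ∈ t, w i = 1) (hA : ∀ i, (A i).PosSemidef) {s : ℝ}
    (hs : 0 ≤ s) (hs1 : s ≤ 1) :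
    ∑ i ∈ t, w i • mpow (A i) s ≤ mpow (∑ i ∈ t, w i • A i) s := by
  have h := (CFC.concaveOn_rpow (A := Matrix n n ℂ) (p := s) ⟨hs, hs1⟩).le_map_sum (p := A)
    hw hw1 (fun i _ => (hA i).nonneg)
  have hS : (∑ i ∈ t, w i • A i).PosSemidef :=
    posSemidef_sum t fun i hi => smul_posSemidef (hA i) (hw i hi)
  simpa only [rpow_eq_mpow hS, rpow_eq_mpow (hA _)] using h

end OperatorMonotone

section Averages

variable {k : ℕ} {V W : Type*} [AddCommGroup V] [Module ℝ V] [AddCommGroup W] [Module ℝ W]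

/-- The value `±1` of a sign. -/
def sgn (b : Bool) : ℝ := if b then 1 else -1

lemma sgn_mul_self (b : Bool) : sgn b * sgn b = 1 := by cases b <;> simp [sgn]

lemma sgn_not (b : Bool) : sgn (!b) = -sgn b := by cases b <;> simp [sgn]

/-- The expectation over independent random signs. -/
noncomputable def avg (f : (Fin k → Bool) → V) : V := ((2 : ℝ) ^ k)⁻¹ • ∑ ε, f ε

lemma avg_add (f g : (Fin k → Bool) → V) : avg (fun ε => f ε + g ε) = avg f + avg g := by
  simp [avg, Finset.sum_add_distrib]

lemma avg_sub (f g : (Fin k → Bool) → V) : avg (fun ε => f ε - g ε) = avg f - avg g := by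
  simp [avg, Finset.sum_sub_distrib, smul_sub]

lemma map_avg (L : V →ₗ[ℝ] W) (f : (Fin k → Bool) → V) : L (avg f) = avg fun ε => L (f ε) := by
  simp [avg]

lemma avg_smul (c : ℝ) (f : (Fin k → Bool) → V) : avg (fun ε => c • f ε) = c • avg f := by
  simp only [avg, ← Finset.smul_sum, smul_comm c]

lemma avg_sum {ι : Type*} (s : Finset ι) (f : ι → (Fin k → Bool) → V) :
    avg (fun ε => ∑ i ∈ s, f i ε) = ∑ i ∈ s, avg (f i) := by
  simp only [avg]
  rw [Finset.sum_comm, Finset.smul_sum]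

lemma avg_const (v : V) : avg (fun _ : Fin k → Bool => v) = v := by
  simp only [avg, Finset.sum_const, Finset.card_univ, Fintype.card_pi, Fintype.card_bool,
    Finset.prod_const, Fintype.card_fin]
  rw [← Nat.cast_smul_eq_nsmul ℝ, smul_smul]
  simp

lemma avg_mono {f g : (Fin k → Bool) → ℝ} (h : ∀ ε, f ε ≤ g ε) : avg f ≤ avg g := by
  simp only [avg, smul_eq_mul]
  gcongr with ε
  exact h ε

lemma avg_nonneg {f : (Fin k → Bool) → ℝ} (h : ∀ ε, 0 ≤ f ε) : 0 ≤ avg f := by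
  have := avg_mono h
  rwa [avg_const] at this

/-- Changing the sign with index `i`. -/
def flip (i : Fin k) (ε : Fin k → Bool) : Fin k → Bool := Function.update ε i (!ε i)

lemma flip_flip (i : Fin k) (ε : Fin k → Bool) : flip i (flip i ε) = ε := by
  simp [flip]

lemma flip_self (i : Fin k) (ε : Fin k → Bool) : flip i ε i = !ε i := by simp [flip]

lemma flip_ne {i j : Fin k} (h : j ≠ i) (ε : Fin k → Bool) : flip i ε j = ε j := by
  simp [flip, h]

lemma avg_flip (i : Fin k) (f : (Fin k → Bool) → V) : avg (fun ε => f (flip i ε)) = avg f := by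
  simp only [avg]
  congr 1
  exact Fintype.sum_equiv ⟨flip i, flip i, flip_flip i, flip_flip i⟩ _ _ fun _ => rfl

lemma avg_sgn_mul_sgn (i j : Fin k) :
    avg (fun ε => sgn (ε i) * sgn (ε j)) = if i = j then 1 else 0 := by
  split_ifs with h
  · subst h
    simp only [sgn_mul_self, avg_const]
  · have h1 := avg_flip i fun ε => sgn (ε i) * sgn (ε j)
    simp only [flip_self, flip_ne (Ne.symm h), sgn_not, neg_mul] at h1
    have h2 := avg_smul (-1) fun ε : Fin k → Bool => sgn (ε i) * sgn (ε j)
    simp only [smul_eq_mul, neg_mul, one_mul] at h2 h1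
    linarith

/-- Rademacher sums. -/
noncomputable def rad (x : Fin k → V) (ε : Fin k → Bool) : V := ∑ i, sgn (ε i) • x i

lemma rad_flip (x : Fin k → V) (i : Fin k) (ε : Fin k → Bool) :
    rad x (flip i ε) = rad x ε - (2 * sgn (ε i)) • x i := by
  rw [eq_sub_iff_add_eq, rad, rad, ← Finset.add_sum_erase _ _ (Finset.mem_univ i),
    ← Finset.add_sum_erase Finset.univ (fun j => sgn (ε j) • x j) (Finset.mem_univ i)]
  rw [Finset.sum_congr rfl fun j hj => by rw [flip_ne (Finset.ne_of_mem_erase hj)]]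
  rw [flip_self, sgn_not]
  module

lemma avg_sgn_smul_rad (x : Fin k → V) (i : Fin k) :
    avg (fun ε => sgn (ε i) • rad x ε) = x i := by
  simp only [rad, Finset.smul_sum, smul_smul]
  rw [avg_sum, Finset.sum_eq_single i]
  · simp only [sgn_mul_self, one_smul, avg_const]
  · intro j _ hj
    have := map_avg ((LinearMap.id (R := ℝ) (M := ℝ)).smulRight (x j))
      fun ε : Fin k → Bool => sgn (ε i) * sgn (ε j)
    simp only [LinearMap.smulRight_apply, LinearMap.id_apply] at this
    rw [← this, avg_sgn_mul_sgn, if_neg hj.symm, zero_smul]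
  · simp

lemma avg_rad_bilin {U : Type*} [AddCommGroup U] [Module ℝ U] (L : V →ₗ[ℝ] W →ₗ[ℝ] U)
    (x : Fin k → V) (f : (Fin k → Bool) → W) :
    avg (fun ε => L (rad x ε) (f ε)) = ∑ i, L (x i) (avg fun ε => sgn (ε i) • f ε) := by
  simp only [rad, map_sum, map_smul, LinearMap.sum_apply, LinearMap.smul_apply]
  rw [avg_sum]
  refine Finset.sum_congr rfl fun i _ => ?_
  rw [map_avg]
  simp only [map_smul]

lemma avg_cauchy_schwarz (f g : (Fin k → Bool) → ℝ) :
    avg (fun ε => f ε * g ε) ≤ √(avg fun ε => f ε ^ 2) * √(avg fun ε => g ε ^ 2) := by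
  rw [← Real.sqrt_mul (avg_nonneg fun ε => sq_nonneg _)]
  apply Real.le_sqrt_of_sq_le
  have := Finset.sum_mul_sq_le_sq_mul_sq Finset.univ f g
  simp only [avg, smul_eq_mul]
  have h2 : 0 ≤ (((2 : ℝ) ^ k)⁻¹) ^ 2 := by positivity
  nlinarith [mul_le_mul_of_nonneg_left this h2]

lemma avg_rpow_le {f : (Fin k → Bool) → ℝ} (hf : ∀ ε, 0 ≤ f ε) {s : ℝ} (hs : 0 ≤ s)
    (hs1 : s ≤ 1) : avg (fun ε => f ε ^ s) ≤ avg f ^ s := by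
  have h := (Real.concaveOn_rpow hs hs1).le_map_sum (t := Finset.univ) (p := f)
    (w := fun _ => ((2 : ℝ) ^ k)⁻¹) (fun _ _ => by positivity) (by simp) (fun ε _ => hf ε)
  simpa only [avg, smul_eq_mul, Finset.mul_sum] using h

lemma avg_succ (f : (Fin (k + 1) → Bool) → V) :
    avg f = avg fun ε : Fin k → Bool =>
      (2 : ℝ)⁻¹ • (f (Fin.cons true ε) + f (Fin.cons false ε)) := by
  simp only [avg]
  rw [← Equiv.sum_comp (Fin.consEquiv fun _ => Bool), Fintype.sum_prod_type, Fintype.sum_bool,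
    ← Finset.smul_sum, smul_smul, ← Finset.sum_add_distrib, pow_succ, mul_inv]
  rfl

lemma rad_cons (x : Fin (k + 1) → V) (b : Bool) (ε : Fin k → Bool) :
    rad x (Fin.cons b ε) = sgn b • x 0 + rad (fun i => x i.succ) ε := by
  simp [rad, Fin.sum_univ_succ]

end Averages

section Khintchine

open scoped MatrixOrder

variable {n : Type*} [Fintype n] [DecidableEq n] {k : ℕ}

/-- The real trace pairing. -/
noncomputable def trPair : Matrix n n ℂ →ₗ[ℝ] Matrix n n ℂ →ₗ[ℝ] ℝ :=
  LinearMap.mk₂ ℝ (fun A B => (A * B).trace.re) (by simp [Matrix.add_mul]) (by simp)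
    (by simp [Matrix.mul_add]) (by simp)

lemma trPair_apply (A B : Matrix n n ℂ) : trPair A B = (A * B).trace.re := rfl

lemma trPair_comm (A B : Matrix n n ℂ) : trPair A B = trPair B A := by
  rw [trPair_apply, trPair_apply, trace_mul_comm]

/-- The trace of a function of a Hermitian matrix. -/
noncomputable def trFun (f : ℝ → ℝ) (A : Matrix n n ℂ) : ℝ := (fc f A).trace.re

/-- The Schatten norm of a Hermitian matrix. -/
noncomputable def hnorm (p : ℝ) (A : Matrix n n ℂ) : ℝ := trFun (fun t => |t| ^ p) A ^ (1 / p)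

lemma trFun_eq {A : Matrix n n ℂ} (hA : A.IsHermitian) (f : ℝ → ℝ) :
    trFun f A = ∑ i, f (hA.eigenvalues i) := re_trace_fc hA f

lemma trFun_nonneg {A : Matrix n n ℂ} (hA : A.IsHermitian) {f : ℝ → ℝ} (hf : ∀ t, 0 ≤ f t) :
    0 ≤ trFun f A := by
  rw [trFun_eq hA]
  exact Finset.sum_nonneg fun i _ => hf _

lemma trPair_fc {A B : Matrix n n ℂ} (hA : A.IsHermitian) (hB : B.IsHermitian) (f g : ℝ → ℝ) :
    trPair (fc f A) (fc g B) =
      ∑ i, ∑ j, f (hA.eigenvalues i) * g (hB.eigenvalues j) * overlap hA hB i j :=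
  trace_fc_mul_fc hA hB f g

lemma trPair_holder {A B : Matrix n n ℂ} (hA : A.IsHermitian) (hB : B.IsHermitian) {u p : ℝ}
    (h : u.HolderConjugate p) : trPair A B ≤ hnorm u A * hnorm p B := by
  have h1 := trPair_fc hA hB (fun x => x) (fun x => x)
  rw [fc_id hA, fc_id hB] at h1
  rw [h1, hnorm, hnorm, trFun_eq hA, trFun_eq hB]
  rw [← Finset.sum_product']
  have hP := fun z : n × n => overlap_nonneg hA hB z.1 z.2
  have key := Real.inner_le_Lp_mul_Lq (Finset.univ ×ˢ Finset.univ : Finset (n × n))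
    (fun z => |hA.eigenvalues z.1| * overlap hA hB z.1 z.2 ^ (1 / u))
    (fun z => |hB.eigenvalues z.2| * overlap hA hB z.1 z.2 ^ (1 / p)) h
  have e1 : ∀ z : n × n, |(|hA.eigenvalues z.1| * overlap hA hB z.1 z.2 ^ (1 / u))| ^ u =
      |hA.eigenvalues z.1| ^ u * overlap hA hB z.1 z.2 := fun z => by
    rw [abs_of_nonneg (mul_nonneg (abs_nonneg _) (Real.rpow_nonneg (hP z) _)),
      Real.mul_rpow (abs_nonneg _) (Real.rpow_nonneg (hP z) _), ← Real.rpow_mul (hP z),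
      one_div_mul_cancel h.ne_zero, Real.rpow_one]
  have e2 : ∀ z : n × n, |(|hB.eigenvalues z.2| * overlap hA hB z.1 z.2 ^ (1 / p))| ^ p =
      |hB.eigenvalues z.2| ^ p * overlap hA hB z.1 z.2 := fun z => by
    rw [abs_of_nonneg (mul_nonneg (abs_nonneg _) (Real.rpow_nonneg (hP z) _)),
      Real.mul_rpow (abs_nonneg _) (Real.rpow_nonneg (hP z) _), ← Real.rpow_mul (hP z),
      one_div_mul_cancel h.symm.ne_zero, Real.rpow_one]
  simp only [e1, e2] at key
  have s1 : ∑ z ∈ (Finset.univ ×ˢ Finset.univ : Finset (n × n)),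
      |hA.eigenvalues z.1| ^ u * overlap hA hB z.1 z.2 = ∑ i, |hA.eigenvalues i| ^ u := by
    rw [Finset.sum_product]
    simp only [← Finset.mul_sum, sum_overlap_right, mul_one]
  have s2 : ∑ z ∈ (Finset.univ ×ˢ Finset.univ : Finset (n × n)),
      |hB.eigenvalues z.2| ^ p * overlap hA hB z.1 z.2 = ∑ i, |hB.eigenvalues i| ^ p := by
    rw [Finset.sum_product_right]
    simp only [← Finset.mul_sum, sum_overlap_left, mul_one]
  rw [s1, s2] at key
  refine le_trans (Finset.sum_le_sum fun z _ => ?_) key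
  have : overlap hA hB z.1 z.2 ^ (1 / u) * overlap hA hB z.1 z.2 ^ (1 / p) =
      overlap hA hB z.1 z.2 := by
    rw [← Real.rpow_add_of_nonneg (hP z) h.one_div_nonneg h.symm.one_div_nonneg, one_div, one_div,
      h.inv_add_inv_eq_one, Real.rpow_one]
  calc _ ≤ |hA.eigenvalues z.1| * |hB.eigenvalues z.2| * overlap hA hB z.1 z.2 := by
        rw [← abs_mul]
        exact mul_le_mul_of_nonneg_right (le_abs_self _) (hP z)
    _ = |hA.eigenvalues z.1| * |hB.eigenvalues z.2| * (overlap hA hB z.1 z.2 ^ (1 / u) *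
          overlap hA hB z.1 z.2 ^ (1 / p)) := by rw [this]
    _ = _ := by ring

lemma trPair_fc_le {A B : Matrix n n ℂ} (hA : A.IsHermitian) (hB : B.IsHermitian) {f : ℝ → ℝ}
    {c : ℝ} (hf : ∀ i, |f (hA.eigenvalues i)| ≤ c) : trPair (fc f A) B ≤ c * hnorm 1 B := by
  have h1 := trPair_fc hA hB f (fun x => x)
  rw [fc_id hB] at h1
  simp only [h1, hnorm, Real.rpow_one, div_one]
  rw [trFun_eq hB]
  calc ∑ i, ∑ j, f (hA.eigenvalues i) * hB.eigenvalues j * overlap hA hB i j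
      ≤ ∑ i, ∑ j, c * |hB.eigenvalues j| * overlap hA hB i j := by
        refine Finset.sum_le_sum fun i _ => Finset.sum_le_sum fun j _ =>
          mul_le_mul_of_nonneg_right ?_ (overlap_nonneg _ _ _ _)
        refine (le_abs_self _).trans ?_
        rw [abs_mul]
        exact mul_le_mul_of_nonneg_right (hf i) (abs_nonneg _)
    _ = _ := by
        rw [Finset.sum_comm, Finset.mul_sum]
        simp only [← Finset.mul_sum, sum_overlap_left, mul_one]

omit [Fintype n] [DecidableEq n] in
lemma isHermitian_rad {x : Fin k → Matrix n n ℂ} (hx : ∀ i, (x i).IsHermitian)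
    (ε : Fin k → Bool) : (rad x ε).IsHermitian := by
  rw [rad, IsHermitian, conjTranspose_sum]
  exact Finset.sum_congr rfl fun i _ => by rw [conjTranspose_smul, hx i]; simp

omit [Fintype n] [DecidableEq n] in
lemma isHermitian_avg {f : (Fin k → Bool) → Matrix n n ℂ} (hf : ∀ ε, (f ε).IsHermitian) :
    (avg f).IsHermitian := by
  rw [avg, IsHermitian, conjTranspose_smul, conjTranspose_sum]
  simp only [fun ε => (hf ε).eq, star_trivial]

lemma sum_trPair_eq_avg (y x : Fin k → Matrix n n ℂ) :
    ∑ i, trPair (y i) (x i) = avg fun ε => trPair (rad y ε) (rad x ε) := by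
  rw [avg_rad_bilin trPair y (rad x)]
  simp only [avg_sgn_smul_rad]

/-- The monotone function `t ↦ t |t| ^ a` has difference quotients bounded by its derivative. -/
lemma mul_abs_rpow_sub_le {a : ℝ} (ha : 0 ≤ a) (x y : ℝ) :
    (x - y) * (x * |x| ^ a - y * |y| ^ a) ≤ (1 + a) * ((x - y) ^ 2 * (|x| ^ a + |y| ^ a)) := by
  have tangent : ∀ s t : ℝ, 0 ≤ t → t ≤ s → 0 < s →
      s * s ^ a - t * t ^ a ≤ (1 + a) * ((s - t) * s ^ a) := by
    intro s t ht hts hs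
    have h1 := one_add_mul_self_le_rpow_one_add (s := t / s - 1) (by
      have : 0 ≤ t / s := by positivity
      linarith) (p := 1 + a) (by linarith)
    rw [add_sub_cancel, Real.div_rpow ht hs.le, le_div_iff₀ (by positivity)] at h1
    have e1 : s ^ (1 + a) = s * s ^ a := by rw [Real.rpow_add hs, Real.rpow_one]
    have e2 : t ^ (1 + a) = t * t ^ a := by
      rw [Real.rpow_add_of_nonneg ht zero_le_one ha, Real.rpow_one]
    rw [e1, e2] at h1
    have : (1 + (1 + a) * (t / s - 1)) * (s * s ^ a) =
        s * s ^ a - (1 + a) * ((s - t) * s ^ a) := by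
      field_simp
      ring
    linarith
  have nonneg : ∀ s t : ℝ, 0 ≤ t → t ≤ s →
      (s - t) * (s * s ^ a - t * t ^ a) ≤ (1 + a) * ((s - t) ^ 2 * (s ^ a + t ^ a)) := by
    intro s t ht hts
    rcases hts.eq_or_lt with rfl | h
    · simp
    · have h1 := mul_le_mul_of_nonneg_left (tangent s t ht hts (ht.trans_lt h))
        (sub_nonneg.2 hts)
      have h2 : 0 ≤ (1 + a) * ((s - t) ^ 2 * t ^ a) := by positivity
      nlinarith
  have opposite : ∀ s t : ℝ, 0 ≤ s → 0 ≤ t →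
      (s + t) * (s * s ^ a + t * t ^ a) ≤ (1 + a) * ((s + t) ^ 2 * (s ^ a + t ^ a)) := by
    intro s t hs ht
    have h1 : 0 ≤ s ^ a := Real.rpow_nonneg hs a
    have h2 : 0 ≤ t ^ a := Real.rpow_nonneg ht a
    have h3 : s * s ^ a + t * t ^ a ≤ (s + t) * (s ^ a + t ^ a) := by
      nlinarith [mul_nonneg hs h2, mul_nonneg ht h1]
    have h4 := mul_le_mul_of_nonneg_left h3 (add_nonneg hs ht)
    have h5 : 0 ≤ a * ((s + t) ^ 2 * (s ^ a + t ^ a)) := by positivity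
    nlinarith
  rcases le_total 0 x with hx | hx <;> rcases le_total 0 y with hy | hy
  · rw [abs_of_nonneg hx, abs_of_nonneg hy]
    rcases le_total y x with h | h
    · exact nonneg x y hy h
    · linarith [nonneg y x hx h]
  · rw [abs_of_nonneg hx, abs_of_nonpos hy]
    have := opposite x (-y) hx (by linarith)
    linarith
  · rw [abs_of_nonpos hx, abs_of_nonneg hy]
    have := opposite (-x) y (by linarith) hy
    linarith
  · rw [abs_of_nonpos hx, abs_of_nonpos hy]
    rcases le_total y x with h | h
    · have := nonneg (-y) (-x) (by linarith) (by linarith)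
      linarith
    · have := nonneg (-x) (-y) (by linarith) (by linarith)
      linarith

lemma trPair_sub_le {A B : Matrix n n ℂ} (hA : A.IsHermitian) (hB : B.IsHermitian) {a : ℝ}
    (ha : 0 ≤ a) :
    trPair (A - B) (fc (fun t => t * |t| ^ a) A - fc (fun t => t * |t| ^ a) B) ≤
      (1 + a) * trPair ((A - B) * (A - B)) (fc (fun t => |t| ^ a) A + fc (fun t => |t| ^ a) B) := by
  set F : ℝ → ℝ := fun t => t * |t| ^ a with hF
  set g : ℝ → ℝ := fun t => |t| ^ a with hg
  have diagA : ∀ f : ℝ → ℝ, (fc f A).trace.re = ∑ i, ∑ j, f (hA.eigenvalues i) *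
      overlap hA hB i j := fun f => by
    rw [re_trace_fc hA]
    simp only [← Finset.mul_sum, sum_overlap_right, mul_one]
  have diagB : ∀ f : ℝ → ℝ, (fc f B).trace.re = ∑ i, ∑ j, f (hB.eigenvalues j) *
      overlap hA hB i j := fun f => by
    rw [re_trace_fc hB, Finset.sum_comm]
    simp only [← Finset.mul_sum, sum_overlap_left, mul_one]
  have e1 : trPair (A - B) (fc F A - fc F B) = ∑ i, ∑ j,
      (hA.eigenvalues i - hB.eigenvalues j) * (F (hA.eigenvalues i) - F (hB.eigenvalues j)) *
        overlap hA hB i j := by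
    have a1 : trPair A (fc F A) = (fc (fun t => t * F t) A).trace.re := by
      rw [trPair_apply]; nth_rw 1 [← fc_id hA]; rw [fc_mul]
    have a2 : trPair B (fc F B) = (fc (fun t => t * F t) B).trace.re := by
      rw [trPair_apply]; nth_rw 1 [← fc_id hB]; rw [fc_mul]
    have a3 := trPair_fc hA hB (fun x => x) F
    have a4 := trPair_fc hA hB F (fun x => x)
    rw [fc_id hA] at a3
    rw [fc_id hB] at a4
    simp only [map_sub, LinearMap.sub_apply]
    rw [a1, a2, a3, trPair_comm B, a4, diagA, diagB]
    simp only [← Finset.sum_sub_distrib]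
    exact Finset.sum_congr rfl fun i _ => Finset.sum_congr rfl fun j _ => by ring
  have e2 : trPair ((A - B) * (A - B)) (fc g A + fc g B) = ∑ i, ∑ j,
      (hA.eigenvalues i - hB.eigenvalues j) ^ 2 *
        (g (hA.eigenvalues i) + g (hB.eigenvalues j)) * overlap hA hB i j := by
    have a1 : (A * A * fc g A).trace.re = (fc (fun t => t ^ 2 * g t) A).trace.re := by
      rw [← fc_sq hA, fc_mul]
    have a2 : (B * B * fc g B).trace.re = (fc (fun t => t ^ 2 * g t) B).trace.re := by
      rw [← fc_sq hB, fc_mul]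
    have a3 := trPair_fc hA hB (fun x => x ^ 2) g
    have a4 := trPair_fc hA hB g (fun x => x ^ 2)
    rw [fc_sq hA, trPair_apply] at a3
    rw [fc_sq hB, trPair_apply, trace_mul_comm] at a4
    have c1 : A * fc g A = fc (fun t => t * g t) A := by
      nth_rw 1 [← fc_id hA]; rw [fc_mul]
    have c1' : fc g A * A = fc (fun t => t * g t) A := by
      nth_rw 2 [← fc_id hA]; rw [fc_mul]; simp only [mul_comm]
    have c2 : B * fc g B = fc (fun t => t * g t) B := by
      nth_rw 1 [← fc_id hB]; rw [fc_mul]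
    have c2' : fc g B * B = fc (fun t => t * g t) B := by
      nth_rw 2 [← fc_id hB]; rw [fc_mul]; simp only [mul_comm]
    have d1 := trPair_fc hA hB (fun t => t * g t) (fun x => x)
    have d2 := trPair_fc hA hB (fun x => x) (fun t => t * g t)
    rw [fc_id hB, trPair_apply] at d1
    rw [fc_id hA, trPair_apply] at d2
    have f1 : (A * B * fc g A).trace.re = (fc (fun t => t * g t) A * B).trace.re := by
      rw [trace_mul_comm, ← mul_assoc, c1']
    have f2 : (B * A * fc g A).trace.re = (fc (fun t => t * g t) A * B).trace.re := by
      rw [mul_assoc, trace_mul_comm, c1]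
    have f3 : (A * B * fc g B).trace.re = (A * fc (fun t => t * g t) B).trace.re := by
      rw [mul_assoc, c2]
    have f4 : (B * A * fc g B).trace.re = (A * fc (fun t => t * g t) B).trace.re := by
      rw [trace_mul_comm, ← mul_assoc, c2', trace_mul_comm]
    have ex : trPair ((A - B) * (A - B)) (fc g A + fc g B) =
        (A * A * fc g A).trace.re + (A * A * fc g B).trace.re - (A * B * fc g A).trace.re
        - (A * B * fc g B).trace.re - (B * A * fc g A).trace.re - (B * A * fc g B).trace.re
        + (B * B * fc g A).trace.re + (B * B * fc g B).trace.re := by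
      rw [trPair_apply]
      simp only [Matrix.sub_mul, Matrix.mul_sub, Matrix.mul_add, trace_add, trace_sub,
        Complex.add_re, Complex.sub_re]
      ring
    rw [ex, a1, a2, a3, a4, f1, f2, f3, f4, d1, d2, diagA, diagB]
    simp only [← Finset.sum_sub_distrib, ← Finset.sum_add_distrib]
    exact Finset.sum_congr rfl fun i _ => Finset.sum_congr rfl fun j _ => by ring
  rw [e1, e2, Finset.mul_sum]
  refine Finset.sum_le_sum fun i _ => ?_
  rw [Finset.mul_sum]
  refine Finset.sum_le_sum fun j _ => ?_
  have := mul_le_mul_of_nonneg_right (mul_abs_rpow_sub_le ha (hA.eigenvalues i) (hB.eigenvalues j))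
    (overlap_nonneg hA hB i j)
  calc _ ≤ _ := this
    _ = _ := by ring

end Khintchine

section Khintchine

open scoped MatrixOrder

variable {n : Type*} [Fintype n] [DecidableEq n] {k : ℕ}

lemma avg_trFun_rad_le {y : Fin k → Matrix n n ℂ} (hy : ∀ i, (y i).IsHermitian) {a : ℝ}
    (ha : 0 ≤ a) :
    avg (fun ε => trFun (fun t => |t| ^ (a + 2)) (rad y ε)) ≤
      2 * (1 + a) * avg fun ε => ∑ i, trPair (y i * y i) (fc (fun t => |t| ^ a) (rad y ε)) := by
  set F : ℝ → ℝ := fun t => t * |t| ^ a with hF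
  set g : ℝ → ℝ := fun t => |t| ^ a with hg
  have hY := isHermitian_rad hy
  have h1 : ∀ ε, trFun (fun t => |t| ^ (a + 2)) (rad y ε) = trPair (rad y ε) (fc F (rad y ε)) := by
    intro ε
    rw [trPair_apply]
    nth_rw 2 [← fc_id (hY ε)]
    rw [fc_mul, trFun]
    congr 3
    funext t
    rw [Real.rpow_add_of_nonneg (abs_nonneg t) ha zero_le_two, Real.rpow_two, sq_abs]
    ring
  simp only [h1]
  rw [avg_rad_bilin trPair y, avg_sum, Finset.mul_sum]
  refine Finset.sum_le_sum fun i _ => ?_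
  rw [map_avg]
  have h2 := avg_flip i fun ε => trPair (y i) (sgn (ε i) • fc F (rad y ε))
  have h3 : avg (fun ε => trPair (y i) (sgn (ε i) • fc F (rad y ε))) = avg fun ε =>
      (1 / 4 : ℝ) • trPair (rad y ε - rad y (flip i ε))
        (fc F (rad y ε) - fc F (rad y (flip i ε))) := by
    have h4 := avg_add (fun ε => trPair (y i) (sgn (ε i) • fc F (rad y ε)))
      (fun ε => trPair (y i) (sgn (flip i ε i) • fc F (rad y (flip i ε))))
    rw [h2] at h4
    have h5 : ∀ ε, trPair (y i) (sgn (ε i) • fc F (rad y ε)) +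
        trPair (y i) (sgn (flip i ε i) • fc F (rad y (flip i ε))) = (2 : ℝ) •
          ((1 / 4 : ℝ) • trPair (rad y ε - rad y (flip i ε))
            (fc F (rad y ε) - fc F (rad y (flip i ε)))) := by
      intro ε
      rw [flip_self, sgn_not]
      have e : rad y ε - rad y (flip i ε) = (2 * sgn (ε i)) • y i := by
        rw [rad_flip, sub_sub_cancel]
      rw [e]
      simp only [map_smul, LinearMap.smul_apply, map_sub, smul_eq_mul]
      ring
    simp only [h5] at h4
    rw [avg_smul, smul_eq_mul] at h4
    linarith
  rw [h3]
  have h6 : ∀ ε, (1 / 4 : ℝ) • trPair (rad y ε - rad y (flip i ε))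
      (fc F (rad y ε) - fc F (rad y (flip i ε))) ≤ (1 + a) * (trPair (y i * y i)
        (fc g (rad y ε)) + trPair (y i * y i) (fc g (rad y (flip i ε)))) := by
    intro ε
    have := trPair_sub_le (hY ε) (hY (flip i ε)) ha
    rw [smul_eq_mul]
    have e : (rad y ε - rad y (flip i ε)) * (rad y ε - rad y (flip i ε)) =
        (4 : ℝ) • (y i * y i) := by
      rw [rad_flip, sub_sub_cancel, Matrix.smul_mul, Matrix.mul_smul, smul_smul]
      congr 1
      linear_combination 4 * sgn_mul_self (ε i)
    rw [e] at this
    simp only [map_smul, LinearMap.smul_apply, map_add, smul_eq_mul] at this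
    linarith
  refine (avg_mono h6).trans_eq ?_
  have h7 := avg_smul (1 + a) fun ε => (trPair (y i * y i)
        (fc g (rad y ε)) + trPair (y i * y i) (fc g (rad y (flip i ε))))
  simp only [smul_eq_mul] at h7
  rw [h7, avg_add, avg_flip i fun ε => trPair (y i * y i) (fc g (rad y ε))]
  ring

/-- The dual noncommutative Khintchine inequality for exponents `1 < p ≤ 2`. -/
lemma sum_trPair_le_of_lt_one {y x : Fin k → Matrix n n ℂ} (hy : ∀ i, (y i).IsHermitian)
    (hx : ∀ i, (x i).IsHermitian) {θ u p B : ℝ} (hθ : 0 ≤ θ) (hθ1 : θ < 1)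
    (hB0 : 0 ≤ B) (hu : u * (1 - θ) = 2) (hp : p * (1 + θ) = 2)
    (hB : ∀ G : Matrix n n ℂ, G.PosSemidef →
      ∑ i, trPair (y i * y i) (mpow G θ) ≤ B * G.trace.re ^ θ) :
    ∑ i, trPair (y i) (x i) ≤
      √(2 * (u - 1) * B) * √(avg fun ε => hnorm p (rad x ε) ^ 2) := by
  have hY := isHermitian_rad hy
  have h1θ : 0 < 1 - θ := by linarith
  have hu2 : 2 ≤ u := by
    by_contra! h
    nlinarith
  set M : (Fin k → Bool) → ℝ := fun ε => trFun (fun t => |t| ^ u) (rad y ε) with hM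
  have hM0 : ∀ ε, 0 ≤ M ε := fun ε => trFun_nonneg (hY ε) fun t => by positivity
  have h1 : avg M ≤ 2 * (u - 1) * B * avg M ^ θ := by
    have h2 := avg_trFun_rad_le hy (a := u - 2) (by linarith)
    rw [sub_add_cancel, show 1 + (u - 2) = u - 1 by ring] at h2
    refine h2.trans ?_
    rw [mul_assoc (2 * (u - 1))]
    refine mul_le_mul_of_nonneg_left ?_ (by linarith)
    have h3 : ∀ ε, ∑ i, trPair (y i * y i) (fc (fun t => |t| ^ (u - 2)) (rad y ε)) ≤
        B * M ε ^ θ := by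
      intro ε
      have h4 := hB (fc (fun t => |t| ^ u) (rad y ε)) (fc_nonneg (hY ε) fun i => by positivity)
      rw [mpow, fc_comp (hY ε)] at h4
      have h5 : (fun t : ℝ => (|t| ^ u) ^ θ) = fun t => |t| ^ (u - 2) := by
        funext t
        rw [← Real.rpow_mul (abs_nonneg t)]
        congr 1
        linarith
      rwa [h5] at h4
    refine (avg_mono h3).trans ?_
    have h4 := avg_smul B fun ε => M ε ^ θ
    simp only [smul_eq_mul] at h4
    rw [h4]
    exact mul_le_mul_of_nonneg_left (avg_rpow_le hM0 hθ hθ1.le) hB0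
  have h2 : avg M ^ (1 - θ) ≤ 2 * (u - 1) * B := by
    rcases (avg_nonneg hM0).eq_or_lt with h | h
    · rw [← h, Real.zero_rpow h1θ.ne']
      exact mul_nonneg (by linarith) hB0
    · rw [Real.rpow_sub h, Real.rpow_one, div_le_iff₀ (Real.rpow_pos_of_pos h _)]
      exact h1
  rw [sum_trPair_eq_avg]
  have hup : u.HolderConjugate p := by
    rw [Real.holderConjugate_iff]
    refine ⟨by linarith, ?_⟩
    have : u⁻¹ = (1 - θ) / 2 := by rw [inv_eq_one_div, div_eq_div_iff] <;> linarith
    have : p⁻¹ = (1 + θ) / 2 := by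
      have : p ≠ 0 := fun h => by simp [h] at hp
      rw [inv_eq_one_div, div_eq_div_iff] <;> grind
    linarith
  refine (avg_mono fun ε => trPair_holder (hY ε) (isHermitian_rad hx ε) hup).trans ?_
  refine (avg_cauchy_schwarz _ _).trans ?_
  gcongr
  refine le_trans ?_ h2
  have h3 : ∀ ε, hnorm u (rad y ε) ^ 2 = M ε ^ (1 - θ) := by
    intro ε
    rw [hnorm, ← Real.rpow_natCast, ← Real.rpow_mul (hM0 ε)]
    congr 1
    have : u ≠ 0 := by linarith
    field_simp
    push_cast
    linarith
  simp only [h3]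
  exact avg_rpow_le hM0 h1θ.le (by linarith)

omit [Fintype n] [DecidableEq n] in
lemma avg_le_avg {f g : (Fin k → Bool) → Matrix n n ℂ} (h : ∀ ε, f ε ≤ g ε) :
    avg f ≤ avg g := by
  rw [Matrix.le_iff, ← avg_sub]
  exact smul_posSemidef (posSemidef_sum _ fun ε _ => Matrix.le_iff.1 (h ε)) (by positivity)

lemma eigenvalues_le_of_fc_le {A : Matrix n n ℂ} (hA : A.IsHermitian) {f g : ℝ → ℝ}
    (h : fc f A ≤ fc g A) (i : n) : f (hA.eigenvalues i) ≤ g (hA.eigenvalues i) := by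
  rw [Matrix.le_iff, ← fc_sub, fc_eq hA] at h
  have h2 := h.conjTranspose_mul_mul_same (hA.eigenvectorUnitary : Matrix n n ℂ)
  have h3 : (hA.eigenvectorUnitary : Matrix n n ℂ)ᴴ * (hA.eigenvectorUnitary : Matrix n n ℂ) = 1 :=
    Unitary.star_mul_self_of_mem (SetLike.coe_mem _)
  rw [← mul_assoc, ← mul_assoc, h3, one_mul, mul_assoc, h3, mul_one, posSemidef_diagonal_iff] at h2
  have := h2 i
  rwa [Complex.zero_le_real, sub_nonneg] at this

omit [DecidableEq n] in
lemma avg_rad_mul_mul_rad (y : Fin k → Matrix n n ℂ) (C : Matrix n n ℂ) :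
    avg (fun ε => rad y ε * C * rad y ε) = ∑ i, y i * C * y i := by
  have h := avg_rad_bilin (LinearMap.mk₂ ℝ (fun A B : Matrix n n ℂ => A * C * B)
    (by simp [Matrix.add_mul]) (by simp) (by simp [Matrix.mul_add]) (by simp)) y (rad y)
  simpa only [LinearMap.mk₂_apply, avg_sgn_smul_rad] using h

lemma avg_rad_mul_rad (y : Fin k → Matrix n n ℂ) :
    avg (fun ε => rad y ε * rad y ε) = ∑ i, y i * y i := by
  simpa using avg_rad_mul_mul_rad y 1

lemma avg_rad_pow_four_le {y : Fin k → Matrix n n ℂ} (hy : ∀ i, (y i).IsHermitian) :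
    avg (fun ε => rad y ε * rad y ε * (rad y ε * rad y ε)) ≤
      (∑ i, y i * y i) * (∑ i, y i * y i) + (2 : ℝ) • ∑ i, y i * (∑ j, y j * y j) * y i := by
  induction k with
  | zero => simp [avg, rad]
  | succ k ih =>
    have ih := ih fun i => hy i.succ
    set z : Fin k → Matrix n n ℂ := fun i => y i.succ with hz
    set h := y 0 with hh
    set A := ∑ i, z i * z i with hA
    have hsum : ∑ i, y i * y i = h * h + A := Fin.sum_univ_succ _
    have hsum2 : ∑ i, y i * (h * h + A) * y i =
        h * (h * h + A) * h + ∑ i, z i * (h * h) * z i + ∑ i, z i * A * z i := by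
      rw [Fin.sum_univ_succ, add_assoc, ← Finset.sum_add_distrib]
      simp only [Matrix.add_mul, Matrix.mul_add, hz]
      rfl
    have expand : avg (fun ε => rad y ε * rad y ε * (rad y ε * rad y ε)) =
        avg (fun ε => rad z ε * rad z ε * (rad z ε * rad z ε)) +
        (h * h * (h * h) + h * h * A + A * (h * h) + h * A * h + h * A * h +
          ∑ i, z i * (h * h) * z i + ∑ i, z i * (h * h) * z i) -
        avg (fun ε => (h * rad z ε - rad z ε * h)ᴴ * (h * rad z ε - rad z ε * h)) := by
      rw [avg_succ, ← avg_rad_mul_mul_rad, hA, ← avg_rad_mul_rad z]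
      have m1 := map_avg (LinearMap.mulLeft ℝ (h * h)) fun ε => rad z ε * rad z ε
      have m2 := map_avg (LinearMap.mulRight ℝ (h * h)) fun ε => rad z ε * rad z ε
      have m3 := map_avg (LinearMap.mulRight ℝ h ∘ₗ LinearMap.mulLeft ℝ h)
        fun ε => rad z ε * rad z ε
      simp only [LinearMap.comp_apply, LinearMap.mulLeft_apply, LinearMap.mulRight_apply]
        at m1 m2 m3
      rw [m1, m2, m3, ← avg_const (k := k) (h * h * (h * h))]
      simp only [← avg_add, ← avg_sub]
      congr 1
      funext ε
      have c1 : (rad z ε)ᴴ = rad z ε := isHermitian_rad (fun i => hy i.succ) ε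
      have c2 : hᴴ = h := hy 0
      rw [rad_cons, rad_cons, ← hz, ← hh, conjTranspose_sub, conjTranspose_mul, conjTranspose_mul,
        c1, c2]
      simp only [sgn, if_true, Bool.false_eq_true, if_false, one_smul, neg_smul]
      set Y := rad z ε
      rw [inv_smul_eq_iff₀ (two_ne_zero), two_smul]
      noncomm_ring
    have hpos : 0 ≤ avg (fun ε => (h * rad z ε - rad z ε * h)ᴴ * (h * rad z ε - rad z ε * h)) := by
      have := avg_le_avg (f := fun _ => 0) fun ε =>
        (posSemidef_conjTranspose_mul_self (h * rad z ε - rad z ε * h)).nonneg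
      rwa [avg_const] at this
    have hpos2 : 0 ≤ h * h * (h * h) := by
      have := (posSemidef_conjTranspose_mul_self (h * h)).nonneg
      rwa [conjTranspose_mul, (hy 0).eq] at this
    rw [hsum, hsum2, expand]
    rw [← sub_nonneg]
    have := add_nonneg (add_nonneg (add_nonneg (sub_nonneg.2 ih) hpos) hpos2) hpos2
    convert this using 1
    simp only [two_smul]
    noncomm_ring

/-- A sum of squares dominated by the identity. -/
lemma sum_trPair_le_of_sum_sq_le_one_of_bound {x y : Fin k → Matrix n n ℂ}
    (hy : ∀ i, (y i).IsHermitian) (hx : ∀ i, (x i).IsHermitian) (h1 : ∑ i, y i * y i ≤ 1) :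
    ∑ i, trPair (y i) (x i) ≤ 2 ^ k * avg fun ε => hnorm 1 (rad x ε) := by
  have hY := isHermitian_rad hy
  rw [sum_trPair_eq_avg]
  have h := avg_smul (2 ^ k) fun ε => hnorm 1 (rad x ε)
  simp only [smul_eq_mul] at h
  rw [← h]
  refine avg_mono fun ε => ?_
  have h2 : rad y ε * rad y ε ≤ (2 : ℝ) ^ k • (1 : Matrix n n ℂ) := by
    have h3 : rad y ε * rad y ε ≤ ∑ δ, rad y δ * rad y δ := by
      refine Finset.single_le_sum (f := fun δ => rad y δ * rad y δ) (fun δ _ => ?_)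
        (Finset.mem_univ ε)
      have := (posSemidef_conjTranspose_mul_self (rad y δ)).nonneg
      rwa [(hY δ).eq] at this
    refine h3.trans ?_
    have h4 : ∑ δ, rad y δ * rad y δ = (2 : ℝ) ^ k • ∑ i, y i * y i := by
      rw [← avg_rad_mul_rad, avg, smul_smul, mul_inv_cancel₀ (by positivity), one_smul]
    rw [h4, Matrix.le_iff, ← smul_sub]
    exact smul_posSemidef (Matrix.le_iff.1 h1) (by positivity)
  have h3 : ∀ i, |(hY ε).eigenvalues i| ≤ 2 ^ k := by
    intro i
    have h4 : fc (fun t => t ^ 2) (rad y ε) ≤ fc (fun _ => 2 ^ k * 1) (rad y ε) := by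
      rwa [fc_sq (hY ε), fc_const_mul, fc_one (hY ε)]
    have h5 := eigenvalues_le_of_fc_le (hY ε) h4 i
    have h6 : (1 : ℝ) ≤ 2 ^ k := one_le_pow₀ one_le_two
    refine abs_le_of_sq_le_sq ?_ (by positivity)
    nlinarith
  have := trPair_fc_le (hY ε) (isHermitian_rad hx ε) (f := fun x => x) h3
  rwa [fc_id (hY ε)] at this

/-- Truncation at height one. -/
noncomputable def trunc (t : ℝ) : ℝ := max (-1) (min 1 t)

lemma abs_trunc_le (t : ℝ) : |trunc t| ≤ 1 :=
  abs_le.2 ⟨le_max_left _ _, max_le (by norm_num) (min_le_left _ _)⟩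

lemma sub_trunc_sq_le (t : ℝ) : (t - trunc t) * (t - trunc t) ≤ 1 / 16 * (t ^ 2 * t ^ 2) := by
  have : |t - trunc t| ≤ t ^ 2 / 4 := by
    rw [abs_le, trunc]
    rcases le_total 1 t with h | h
    · rw [min_eq_left h, max_eq_right (by norm_num)]
      constructor <;> nlinarith [sq_nonneg (t - 2)]
    · rw [min_eq_right h]
      rcases le_total (-1) t with h' | h'
      · rw [max_eq_right h']
        constructor <;> nlinarith [sq_nonneg t]
      · rw [max_eq_left h']
        constructor <;> nlinarith [sq_nonneg (t + 2)]
  have h2 := mul_self_le_mul_self (abs_nonneg _) this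
  rw [abs_mul_abs_self] at h2
  linarith

lemma sum_sq_le_avg_sq {W : (Fin k → Bool) → Matrix n n ℂ} (hW : ∀ ε, (W ε).IsHermitian) :
    ∑ i, (avg fun ε => sgn (ε i) • W ε) * (avg fun ε => sgn (ε i) • W ε) ≤
      avg fun ε => W ε * W ε := by
  set y : Fin k → Matrix n n ℂ := fun i => avg fun ε => sgn (ε i) • W ε with hy
  have hyH : ∀ i, (y i).IsHermitian := fun i =>
    isHermitian_avg fun ε => by
      rw [IsHermitian, conjTranspose_smul, (hW ε).eq, star_trivial]
  have h := avg_le_avg (f := fun _ => 0) fun ε =>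
    (posSemidef_conjTranspose_mul_self (W ε - rad y ε)).nonneg
  have e : avg (fun ε => (W ε - rad y ε)ᴴ * (W ε - rad y ε)) =
      avg (fun ε => W ε * W ε) - ∑ i, y i * y i := by
    have e1 : ∀ ε, (W ε - rad y ε)ᴴ * (W ε - rad y ε) =
        W ε * W ε - W ε * rad y ε - rad y ε * W ε + rad y ε * rad y ε := fun ε => by
      rw [conjTranspose_sub, (hW ε).eq, (isHermitian_rad hyH ε).eq]
      noncomm_ring
    have e2 := avg_rad_bilin (LinearMap.mul ℝ (Matrix n n ℂ)) y W
    have e3 := avg_rad_bilin (LinearMap.mul ℝ (Matrix n n ℂ)).flip y W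
    simp only [LinearMap.flip_apply, LinearMap.mul_apply'] at e2 e3
    simp only [e1]
    rw [avg_add, avg_sub, avg_sub, e2, e3, avg_rad_mul_rad]
    abel
  rw [avg_const, e] at h
  exact sub_nonneg.1 h

lemma mul_self_le_one {A : Matrix n n ℂ} (hA : A.PosSemidef) (h : A ≤ 1) : A * A ≤ 1 := by
  have hA' := hA.isHermitian
  have h1 : fc (fun x => x) A ≤ fc (fun _ => 1) A := by rwa [fc_id hA', fc_one hA']
  rw [← fc_sq hA', ← fc_one hA']
  refine fc_mono hA' fun i => ?_
  have := eigenvalues_le_of_fc_le hA' h1 i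
  nlinarith [hA.eigenvalues_nonneg i]

/-- The dual noncommutative Khintchine inequality for the trace class, by truncation. -/
lemma sum_trPair_le_of_sum_sq_le_one {x : Fin k → Matrix n n ℂ} (hx : ∀ i, (x i).IsHermitian)
    {y : Fin k → Matrix n n ℂ} (hy : ∀ i, (y i).IsHermitian) (h1 : ∑ i, y i * y i ≤ 1) :
    ∑ i, trPair (y i) (x i) ≤ 2 * avg fun ε => hnorm 1 (rad x ε) := by
  set E := avg fun ε => hnorm 1 (rad x ε) with hE
  have step : ∀ K : ℝ, (∀ y : Fin k → Matrix n n ℂ, (∀ i, (y i).IsHermitian) →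
      ∑ i, y i * y i ≤ 1 → ∑ i, trPair (y i) (x i) ≤ K * E) →
      ∀ y : Fin k → Matrix n n ℂ, (∀ i, (y i).IsHermitian) →
      ∑ i, y i * y i ≤ 1 → ∑ i, trPair (y i) (x i) ≤ (1 + K / 2) * E := by
    intro K hK y hy h1
    have hY := isHermitian_rad hy
    set W : (Fin k → Bool) → Matrix n n ℂ := fun ε => rad y ε - fc trunc (rad y ε) with hWdef
    have hW : ∀ ε, (W ε).IsHermitian := fun ε => (hY ε).sub (isHermitian_fc _ _)
    set z : Fin k → Matrix n n ℂ := fun i => avg fun ε => sgn (ε i) • W ε with hz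
    have hzH : ∀ i, (z i).IsHermitian := fun i =>
      isHermitian_avg fun ε => by
        rw [IsHermitian, conjTranspose_smul, (hW ε).eq, star_trivial]
    have hA : (∑ i, y i * y i).PosSemidef := posSemidef_sum _ fun i _ => by
      have := posSemidef_conjTranspose_mul_self (y i)
      rwa [(hy i).eq] at this
    have combine₁ : ∀ P Q R I : Matrix n n ℂ, (1 / 4 : ℝ) • I - (1 / 16 : ℝ) • R =
        (1 / 16 : ℝ) • ((P + (2 : ℝ) • Q - R) + (I - P) + (2 : ℝ) • (I - Q)) +
          (1 / 16 : ℝ) • I := fun P Q R I => by module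
    have combine₂ : ∀ P I : Matrix n n ℂ, I - ((2 * 2 : ℝ)) • P =
        (4 : ℝ) • ((1 / 4 : ℝ) • I - P) := fun P I => by module
    have hzz : ∑ i, z i * z i ≤ (1 / 4 : ℝ) • (1 : Matrix n n ℂ) := by
      refine (sum_sq_le_avg_sq hW).trans ?_
      have b1 : ∀ ε, W ε * W ε ≤ (1 / 16 : ℝ) • (rad y ε * rad y ε * (rad y ε * rad y ε)) := by
        intro ε
        have w : W ε = fc (fun t => t - trunc t) (rad y ε) := by
          rw [fc_sub, fc_id (hY ε)]
        rw [w, fc_mul, ← fc_sq (hY ε), fc_mul, ← fc_const_mul]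
        exact fc_mono (hY ε) fun i => sub_trunc_sq_le _
      refine (avg_le_avg b1).trans ?_
      rw [avg_smul]
      have b2 := avg_rad_pow_four_le hy
      have b3 := mul_self_le_one hA h1
      have b4 : ∑ i, y i * (∑ j, y j * y j) * y i ≤ 1 := by
        refine le_trans (Finset.sum_le_sum fun i _ => ?_) h1
        have := conj_le_conj h1 (y i)
        rwa [(hy i).eq, mul_one] at this
      rw [Matrix.le_iff] at b2 b3 b4 ⊢
      have := smul_posSemidef ((b2.add b3).add (smul_posSemidef b4 (zero_le_two)))
        (c := 1 / 16) (by norm_num)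
      have := this.add (smul_posSemidef (PosSemidef.one (n := n) (R := ℂ)) (c := 1 / 16)
        (by norm_num))
      rwa [← combine₁] at this
    have hK2 := hK (fun i => (2 : ℝ) • z i) (fun i => by
      rw [IsHermitian, conjTranspose_smul, (hzH i).eq, star_trivial]) (by
      simp only [Matrix.smul_mul, Matrix.mul_smul, smul_smul, ← Finset.smul_sum]
      rw [Matrix.le_iff] at hzz ⊢
      have := smul_posSemidef hzz (c := 4) (by norm_num)
      rwa [← combine₂] at this)
    simp only [map_smul, LinearMap.smul_apply, smul_eq_mul, ← Finset.mul_sum] at hK2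
    have split : ∑ i, trPair (y i) (x i) =
        avg (fun ε => trPair (fc trunc (rad y ε)) (rad x ε)) + ∑ i, trPair (z i) (x i) := by
      have e1 := avg_rad_bilin trPair x W
      simp only [trPair_comm (x _), trPair_comm (rad x _)] at e1
      rw [← e1, ← avg_add, sum_trPair_eq_avg]
      congr 1
      funext ε
      rw [← LinearMap.add_apply, ← map_add, hWdef]
      simp
    have first : avg (fun ε => trPair (fc trunc (rad y ε)) (rad x ε)) ≤ E := by
      refine avg_mono fun ε => ?_
      have := trPair_fc_le (hY ε) (isHermitian_rad hx ε) (f := trunc) (c := 1)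
        fun i => abs_trunc_le _
      rwa [one_mul] at this
    rw [split]
    linarith
  have iter : ∀ j : ℕ, ∀ y : Fin k → Matrix n n ℂ, (∀ i, (y i).IsHermitian) →
      ∑ i, y i * y i ≤ 1 → ∑ i, trPair (y i) (x i) ≤ (2 + 2 ^ k * (1 / 2) ^ j) * E := by
    intro j
    induction j with
    | zero =>
      intro y hy h1
      refine (sum_trPair_le_of_sum_sq_le_one_of_bound hy hx h1).trans ?_
      refine mul_le_mul_of_nonneg_right (by simp) (avg_nonneg fun ε => ?_)
      exact Real.rpow_nonneg (trFun_nonneg (isHermitian_rad hx ε) fun t => by positivity) _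
    | succ j ih =>
      intro y hy h1
      refine (step _ ih y hy h1).trans_eq ?_
      rw [pow_succ]
      ring
  have lim : Filter.Tendsto (fun j : ℕ => (2 + 2 ^ k * (1 / 2 : ℝ) ^ j) * E) Filter.atTop
      (nhds ((2 + 2 ^ k * 0) * E)) :=
    ((tendsto_pow_atTop_nhds_zero_of_lt_one (by norm_num) (by norm_num)).const_mul _
      |>.const_add _).mul_const _
  rw [mul_zero, add_zero] at lim
  exact ge_of_tendsto' lim fun j => iter j y hy h1

end Khintchine

section Interpolation

open scoped MatrixOrder

variable {n : Type*} [Fintype n] [DecidableEq n] {k : ℕ}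

/-- Complex powers of a positive definite matrix. -/
noncomputable def cpow {A : Matrix n n ℂ} (hA : A.IsHermitian) (z : ℂ) : Matrix n n ℂ :=
  (hA.eigenvectorUnitary : Matrix n n ℂ) *
    diagonal (fun i => Complex.exp (z * Real.log (hA.eigenvalues i))) *
      (hA.eigenvectorUnitary : Matrix n n ℂ)ᴴ

lemma cpow_mul_cpow {A : Matrix n n ℂ} (hA : A.IsHermitian) (z w : ℂ) :
    cpow hA z * cpow hA w = cpow hA (z + w) := by
  have h : (hA.eigenvectorUnitary : Matrix n n ℂ)ᴴ * (hA.eigenvectorUnitary : Matrix n n ℂ) = 1 :=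
    Unitary.star_mul_self_of_mem (SetLike.coe_mem _)
  simp only [cpow]
  set U := (hA.eigenvectorUnitary : Matrix n n ℂ)
  rw [mul_assoc, ← mul_assoc Uᴴ, ← mul_assoc Uᴴ, h, one_mul, mul_assoc U, ← mul_assoc (diagonal _),
    diagonal_mul_diagonal, mul_assoc]
  simp only [← Complex.exp_add, ← add_mul]

lemma cpow_zero {A : Matrix n n ℂ} (hA : A.IsHermitian) : cpow hA 0 = 1 := by
  have h : (hA.eigenvectorUnitary : Matrix n n ℂ) * (hA.eigenvectorUnitary : Matrix n n ℂ)ᴴ = 1 :=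
    Unitary.mul_star_self_of_mem (SetLike.coe_mem _)
  simp [cpow, h]

lemma conjTranspose_cpow {A : Matrix n n ℂ} (hA : A.IsHermitian) (z : ℂ) :
    (cpow hA z)ᴴ = cpow hA (star z) := by
  simp only [cpow, conjTranspose_mul, conjTranspose_conjTranspose, diagonal_conjTranspose,
    mul_assoc]
  congr 3
  ext i
  simp [← Complex.exp_conj]

lemma cpow_ofReal {A : Matrix n n ℂ} (hA : A.PosDef) (s : ℝ) :
    cpow hA.isHermitian s = mpow A s := by
  rw [mpow, fc_eq hA.isHermitian, cpow]
  congr 3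
  ext i
  rw [Real.rpow_def_of_pos (hA.eigenvalues_pos i), mul_comm (Real.log _)]
  push_cast
  rfl

lemma conjTranspose_mul_cpow_of_re_eq_zero {A : Matrix n n ℂ} (hA : A.IsHermitian) {z : ℂ}
    (hz : z.re = 0) : (cpow hA z)ᴴ * cpow hA z = 1 := by
  rw [conjTranspose_cpow, cpow_mul_cpow, ← cpow_zero hA]
  congr 1
  apply Complex.ext <;> simp [hz]

/-- Entire functions that are bounded on the unit strip. -/
def StripBounded (f : ℂ → ℂ) : Prop :=
  Differentiable ℂ f ∧ ∃ C, ∀ z : ℂ, 0 ≤ z.re → z.re ≤ 1 → ‖f z‖ ≤ C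

lemma stripBounded_const (c : ℂ) : StripBounded fun _ => c :=
  ⟨differentiable_const c, ‖c‖, fun _ _ _ => le_rfl⟩

lemma StripBounded.mul {f g : ℂ → ℂ} (hf : StripBounded f) (hg : StripBounded g) :
    StripBounded fun z => f z * g z := by
  obtain ⟨hf, C, hC⟩ := hf
  obtain ⟨hg, D, hD⟩ := hg
  refine ⟨hf.mul hg, C * D, fun z h0 h1 => ?_⟩
  rw [norm_mul]
  exact mul_le_mul (hC z h0 h1) (hD z h0 h1) (norm_nonneg _) ((norm_nonneg _).trans (hC z h0 h1))

lemma stripBounded_sum {ι : Type*} (s : Finset ι) {f : ι → ℂ → ℂ}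
    (hf : ∀ i, StripBounded (f i)) : StripBounded fun z => ∑ i ∈ s, f i z := by
  choose h C hC using hf
  refine ⟨Differentiable.fun_sum fun i _ => h i, ∑ i ∈ s, C i, fun z h0 h1 => ?_⟩
  exact (norm_sum_le _ _).trans (Finset.sum_le_sum fun i _ => hC i z h0 h1)

lemma stripBounded_exp (c d l : ℝ) :
    StripBounded fun z => Complex.exp ((c * z + d) * l) := by
  refine ⟨by fun_prop, Real.exp ((|c| + |d|) * |l|), fun z h0 h1 => ?_⟩
  rw [Complex.norm_exp]
  apply Real.exp_le_exp.2
  have : ((c * z + d) * l : ℂ).re = (c * z.re + d) * l := by simp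
  rw [this]
  refine (le_abs_self _).trans ?_
  rw [abs_mul]
  refine mul_le_mul_of_nonneg_right ((abs_add_le _ _).trans ?_) (abs_nonneg _)
  rw [abs_mul, abs_of_nonneg h0]
  nlinarith [abs_nonneg c]

omit [DecidableEq n] in
lemma stripBounded_mul_apply {F G : ℂ → Matrix n n ℂ} (hF : ∀ i j, StripBounded fun z => F z i j)
    (hG : ∀ i j, StripBounded fun z => G z i j) (i j : n) :
    StripBounded fun z => (F z * G z) i j := by
  simp only [Matrix.mul_apply]
  exact stripBounded_sum _ fun l => (hF i l).mul (hG l j)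

lemma stripBounded_cpow {A : Matrix n n ℂ} (hA : A.IsHermitian) (c d : ℝ) (i j : n) :
    StripBounded fun z => cpow hA (c * z + d) i j := by
  set U := (hA.eigenvectorUnitary : Matrix n n ℂ) with hU
  set D : ℂ → Matrix n n ℂ := fun z =>
    diagonal fun i => Complex.exp ((c * z + d) * Real.log (hA.eigenvalues i)) with hD
  have h : ∀ i j, StripBounded fun z => D z i j := by
    intro i j
    simp only [hD, diagonal_apply]
    split_ifs
    · exact stripBounded_exp _ _ _
    · exact stripBounded_const _
  have h1 := stripBounded_mul_apply (F := fun _ => U) (fun i j => stripBounded_const _) h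
  exact stripBounded_mul_apply (F := fun z => U * D z) (G := fun _ => Uᴴ) h1
    (fun i j => stripBounded_const _) i j

omit [DecidableEq n] in
lemma re_trace_conjTranspose_mul_self (X : Matrix n n ℂ) :
    (Xᴴ * X).trace.re = ∑ i, ∑ j, ‖X j i‖ ^ 2 := by
  simp only [trace, diag_apply, Matrix.mul_apply, conjTranspose_apply, Complex.re_sum]
  refine Finset.sum_congr rfl fun i _ => Finset.sum_congr rfl fun j _ => ?_
  rw [Complex.star_def, Complex.conj_mul', ← Complex.ofReal_pow, Complex.ofReal_re]

omit [DecidableEq n] in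
lemma norm_trace_conjTranspose_mul_le (X Y : Matrix n n ℂ) :
    ‖(Xᴴ * Y).trace‖ ≤ ((Xᴴ * X).trace.re + (Yᴴ * Y).trace.re) / 2 := by
  rw [re_trace_conjTranspose_mul_self, re_trace_conjTranspose_mul_self]
  simp only [trace, diag_apply, Matrix.mul_apply, conjTranspose_apply, ← Finset.sum_add_distrib,
    Finset.sum_div]
  refine (norm_sum_le _ _).trans (Finset.sum_le_sum fun i _ => ?_)
  refine (norm_sum_le _ _).trans (Finset.sum_le_sum fun j _ => ?_)
  rw [norm_mul, norm_star]
  nlinarith [sq_nonneg (‖X j i‖ - ‖Y j i‖)]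

/-- A trace estimate for averages of contractions sandwiched between two column contractions. -/
lemma norm_sum_trace_le {A : Matrix n n ℂ} (hA : A.PosSemidef) {w : Fin k → ℝ}
    (hw : ∀ i, 0 ≤ w i) {T C : Fin k → Matrix n n ℂ} {u v : Matrix n n ℂ}
    (hT : ∑ i, w i • ((T i)ᴴ * T i) ≤ 1) (hC : ∀ i, (C i)ᴴ * C i ≤ 1) (hu : uᴴ * u ≤ 1)
    (hv : vᴴ * v ≤ 1) :
    ‖∑ i, (w i : ℂ) * (A * (uᴴ * (T i)ᴴ * C i * T i * v)).trace‖ ≤ A.trace.re := by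
  set h := fc (fun t => √t) A with hh
  have hH : hᴴ = h := isHermitian_fc _ _
  have hhA : h * h = A := by
    rw [hh, fc_mul, fc_congr hA.isHermitian (g := fun x => x)
      fun i => Real.mul_self_sqrt (hA.eigenvalues_nonneg i), fc_id hA.isHermitian]
  have bound : ∀ z : Matrix n n ℂ, zᴴ * z ≤ 1 →
      ∑ i, w i * ((T i * z * h)ᴴ * (T i * z * h)).trace.re ≤ A.trace.re := by
    intro z hz
    have e : ∑ i, w i * ((T i * z * h)ᴴ * (T i * z * h)).trace.re =
        (hᴴ * (zᴴ * (∑ i, w i • ((T i)ᴴ * T i)) * z) * h).trace.re := by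
      simp only [Matrix.mul_sum, Matrix.sum_mul, trace_sum, Complex.re_sum, Matrix.mul_smul,
        Matrix.smul_mul, trace_smul, Complex.smul_re, conjTranspose_mul, mul_assoc, smul_eq_mul]
    rw [e, ← hhA]
    refine re_trace_le ?_
    have h1 := conj_le_conj hT z
    rw [mul_one] at h1
    have h2 := conj_le_conj (h1.trans hz) h
    rw [mul_one, hH] at h2
    rwa [hH]
  have term : ∀ i, (A * (uᴴ * (T i)ᴴ * C i * T i * v)).trace =
      ((T i * u * h)ᴴ * (C i * (T i * v * h))).trace := by
    intro i
    rw [← hhA, conjTranspose_mul, conjTranspose_mul, hH, mul_assoc, trace_mul_comm]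
    simp only [mul_assoc]
  calc _ ≤ ∑ i, w i * ((((T i * u * h)ᴴ * (T i * u * h)).trace.re +
        ((T i * v * h)ᴴ * (T i * v * h)).trace.re) / 2) := by
        refine (norm_sum_le _ _).trans (Finset.sum_le_sum fun i _ => ?_)
        rw [norm_mul, Complex.norm_real, Real.norm_of_nonneg (hw i), term]
        refine mul_le_mul_of_nonneg_left ?_ (hw i)
        refine (norm_trace_conjTranspose_mul_le _ _).trans ?_
        have h1 := re_trace_le (conj_le_conj (hC i) (T i * v * h))
        rw [mul_one] at h1
        have h2 : (C i * (T i * v * h))ᴴ * (C i * (T i * v * h)) =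
            (T i * v * h)ᴴ * ((C i)ᴴ * C i) * (T i * v * h) := by
          rw [conjTranspose_mul (C i)]
          simp only [mul_assoc]
        rw [h2]
        linarith
    _ = (∑ i, w i * ((T i * u * h)ᴴ * (T i * u * h)).trace.re +
        ∑ i, w i * ((T i * v * h)ᴴ * (T i * v * h)).trace.re) / 2 := by
        rw [← Finset.sum_add_distrib, Finset.sum_div]
        exact Finset.sum_congr rfl fun i _ => by ring
    _ ≤ _ := by linarith [bound u hu, bound v hv]

lemma norm_trace_mul_le {A : Matrix n n ℂ} (hA : A.PosSemidef) {v : Matrix n n ℂ}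
    (hv : vᴴ * v ≤ 1) : ‖(A * v).trace‖ ≤ A.trace.re := by
  simpa using norm_sum_trace_le hA (k := 1) (w := fun _ => 1) (T := fun _ => 1) (C := fun _ => 1)
    (u := 1) (v := v) (by simp) (by simp) (by simp) (by simp) hv

lemma isometry_mul {U V : Matrix n n ℂ} (hU : Uᴴ * U = 1) (hV : Vᴴ * V = 1) :
    (U * V)ᴴ * (U * V) = 1 := by
  rw [conjTranspose_mul, mul_assoc, ← mul_assoc Uᴴ, hU, one_mul, hV]

lemma posDef_mpow_neg_conj {R : Matrix n n ℂ} (hR : R.PosDef) (s : ℝ) :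
    (mpow R (-s / 2))ᴴ * mpow R s * mpow R (-s / 2) = 1 := by
  rw [(mpow_isHermitian R _).eq, mpow_mul_mpow hR, mpow_mul_mpow hR]
  have : -s / 2 + s + -s / 2 = 0 := by ring
  rw [this, mpow_zero hR.isHermitian]

/-- The column of weighted relative square roots is a contraction. -/
lemma sum_smul_relative_le_one {w : Fin k → ℝ} (hw : ∀ i, 0 ≤ w i) (hw1 : ∑ i, w i = 1)
    {R : Fin k → Matrix n n ℂ} (hR : ∀ i, (R i).PosDef) {S : Matrix n n ℂ} (hS : S.PosDef)
    (hRS : ∑ i, w i • R i ≤ S) {s : ℝ} (hs : 0 ≤ s) (hs1 : s ≤ 1) :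
    ∑ i, w i • ((mpow (R i) (s / 2) * mpow S (-s / 2))ᴴ *
      (mpow (R i) (s / 2) * mpow S (-s / 2))) ≤ 1 := by
  have h1 := sum_smul_mpow_le (t := Finset.univ) (fun i _ => hw i) hw1
    (fun i => (hR i).posSemidef) hs hs1
  have h2 : (∑ i, w i • R i).PosSemidef :=
    posSemidef_sum _ fun i _ => smul_posSemidef (hR i).posSemidef (hw i)
  have h3 := conj_le_conj (h1.trans (mpow_le_mpow h2 hRS hs hs1)) (mpow S (-s / 2))
  rw [posDef_mpow_neg_conj hS] at h3
  convert h3 using 1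
  simp only [Matrix.mul_sum, Matrix.sum_mul, Matrix.mul_smul, Matrix.smul_mul]
  refine Finset.sum_congr rfl fun i _ => ?_
  rw [conjTranspose_mul, (mpow_isHermitian (R i) _).eq, mul_assoc, ← mul_assoc (mpow (R i) _),
    mpow_mul_mpow (hR i), add_halves, mul_assoc]

/-- The analytic family whose values are compared in `sum_re_trace_interpolation_le`. -/
noncomputable def interpFun {R S Z G : Matrix n n ℂ} (hZ : Z.IsHermitian) (hR : R.IsHermitian)
    (hS : S.IsHermitian) (hG : G.IsHermitian) (s : ℝ) (z : ℂ) : ℂ :=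
  (cpow hZ ((-1 : ℝ) * z + (1 : ℝ)) *
    (cpow hR ((s / 2 : ℝ) * z + (0 : ℝ)) * cpow hS ((-s / 2 : ℝ) * z + (0 : ℝ)) *
      cpow hG ((1 : ℝ) * z + (0 : ℝ)) * (cpow hS ((-s / 2 : ℝ) * z + (0 : ℝ)) *
        cpow hR ((s / 2 : ℝ) * z + (0 : ℝ))))).trace

lemma stripBounded_interpFun {R S Z G : Matrix n n ℂ} (hZ : Z.IsHermitian) (hR : R.IsHermitian)
    (hS : S.IsHermitian) (hG : G.IsHermitian) (s : ℝ) : StripBounded (interpFun hZ hR hS hG s) := by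
  refine stripBounded_sum _ fun j => ?_
  have r := stripBounded_cpow hR (s / 2) 0
  have t := stripBounded_cpow hS (-s / 2) 0
  exact stripBounded_mul_apply (stripBounded_cpow hZ (-1) 1)
    (stripBounded_mul_apply (stripBounded_mul_apply (stripBounded_mul_apply r t)
      (stripBounded_cpow hG 1 0)) (stripBounded_mul_apply t r)) j j

lemma isometry_cpow {A : Matrix n n ℂ} (hA : A.IsHermitian) (c : ℝ) {y : ℂ} (hy : y.re = 0) :
    (cpow hA (c * y))ᴴ * cpow hA (c * y) = 1 :=
  conjTranspose_mul_cpow_of_re_eq_zero hA (by simp [hy])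

lemma cpow_shift {A : Matrix n n ℂ} (hA : A.PosDef) (c : ℝ) (y : ℂ) :
    cpow hA.isHermitian (c + c * y) = cpow hA.isHermitian (c * y) * mpow A c := by
  rw [add_comm, ← cpow_mul_cpow, cpow_ofReal hA]

lemma cpow_comm_mpow {A : Matrix n n ℂ} (hA : A.PosDef) (c : ℝ) (z : ℂ) :
    cpow hA.isHermitian z * mpow A c = mpow A c * cpow hA.isHermitian z := by
  rw [← cpow_ofReal hA, cpow_mul_cpow, cpow_mul_cpow, add_comm]

lemma norm_interpFun_le_of_re_eq_zero {R S Z G : Matrix n n ℂ} (hZ : Z.PosDef)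
    (hR : R.IsHermitian) (hS : S.IsHermitian) (hG : G.IsHermitian) (s : ℝ) {y : ℂ}
    (hy : y.re = 0) : ‖interpFun hZ.isHermitian hR hS hG s y‖ ≤ Z.trace.re := by
  have e : cpow hZ.isHermitian ((-1 : ℝ) * y + (1 : ℝ)) =
      Z * cpow hZ.isHermitian ((-1 : ℝ) * y) := by
    rw [add_comm, ← cpow_mul_cpow, cpow_ofReal hZ, mpow_one hZ.isHermitian]
  rw [interpFun, e]
  simp only [Complex.ofReal_zero, add_zero]
  rw [mul_assoc]
  exact norm_trace_mul_le hZ.posSemidef (isometry_mul (isometry_cpow _ _ hy)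
    (isometry_mul (isometry_mul (isometry_mul (isometry_cpow _ _ hy)
      (isometry_cpow _ _ hy)) (isometry_cpow _ _ hy))
      (isometry_mul (isometry_cpow _ _ hy) (isometry_cpow _ _ hy)))).le

omit [DecidableEq n] in
lemma trace_rotate {a b c d G R S : Matrix n n ℂ} (hR : a * R = R * a) (hS : b * S = S * b) :
    (c * (a * R * (b * S) * (d * G) * (b * S * (a * R)))).trace =
      (G * (b * (S * R) * (a * c * a) * (R * S) * (b * d))).trace := by
  have e : G * (b * (S * R) * (a * c * a) * (R * S) * (b * d)) =
      (G * (b * S * (R * a))) * (c * (a * R * (S * b) * d)) := by simp only [mul_assoc]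
  rw [e, trace_mul_comm (G * _), ← hR, ← hS]
  simp only [mul_assoc]

lemma interpFun_one_add {R S Z G : Matrix n n ℂ} (hZ : Z.IsHermitian) (hR : R.PosDef)
    (hS : S.PosDef) (hG : G.PosDef) (s : ℝ) (y : ℂ) :
    interpFun hZ hR.isHermitian hS.isHermitian hG.isHermitian s (1 + y) =
      (G * (((cpow hS.isHermitian ((-s / 2 : ℝ) * y))ᴴ)ᴴ *
        (mpow R (s / 2) * mpow S (-s / 2))ᴴ *
        (cpow hR.isHermitian ((s / 2 : ℝ) * y) * cpow hZ ((-1 : ℝ) * y) *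
          cpow hR.isHermitian ((s / 2 : ℝ) * y)) * (mpow R (s / 2) * mpow S (-s / 2)) *
        (cpow hS.isHermitian ((-s / 2 : ℝ) * y) *
          cpow hG.isHermitian ((1 : ℝ) * y)))).trace := by
  have e1 : ((-1 : ℝ) * (1 + y) + (1 : ℝ) : ℂ) = (-1 : ℝ) * y := by push_cast; ring
  have e2 : ∀ c : ℝ, ((c : ℝ) * (1 + y) + (0 : ℝ) : ℂ) = c + c * y := fun c => by
    push_cast; ring
  rw [interpFun, e1, e2, e2, e2, cpow_shift hS, cpow_shift hR, cpow_shift hG,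
    mpow_one hG.isHermitian, conjTranspose_conjTranspose, conjTranspose_mul,
    (mpow_isHermitian S _).eq, (mpow_isHermitian R _).eq,
    trace_rotate (cpow_comm_mpow hR _ _) (cpow_comm_mpow hS _ _)]

lemma interpFun_ofReal {R S Z G : Matrix n n ℂ} (hZ : Z.PosDef) (hR : R.PosDef)
    (hS : S.PosDef) (hG : G.PosDef) (s θ : ℝ) :
    interpFun hZ.isHermitian hR.isHermitian hS.isHermitian hG.isHermitian s θ =
      (mpow Z (1 - θ) * (mpow R (s * θ / 2) * mpow S (-(s * θ) / 2) *
      mpow G θ * (mpow S (-(s * θ) / 2) * mpow R (s * θ / 2)))).trace := by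
  have e1 : ((-1 : ℝ) * (θ : ℂ) + (1 : ℝ) : ℂ) = (1 - θ : ℝ) := by push_cast; ring
  have e2 : ((s / 2 : ℝ) * (θ : ℂ) + (0 : ℝ) : ℂ) = (s * θ / 2 : ℝ) := by push_cast; ring
  have e3 : ((-s / 2 : ℝ) * (θ : ℂ) + (0 : ℝ) : ℂ) = (-(s * θ) / 2 : ℝ) := by push_cast; ring
  have e4 : ((1 : ℝ) * (θ : ℂ) + (0 : ℝ) : ℂ) = (θ : ℝ) := by push_cast; ring
  rw [interpFun, e1, e2, e3, e4, cpow_ofReal hZ, cpow_ofReal hR, cpow_ofReal hS, cpow_ofReal hG]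

/-- The interpolation estimate at the heart of the cotype inequality. -/
lemma sum_re_trace_interpolation_le {w : Fin k → ℝ} (hw : ∀ i, 0 ≤ w i) (hw1 : ∑ i, w i = 1)
    {R Z : Fin k → Matrix n n ℂ} (hR : ∀ i, (R i).PosDef) {S G : Matrix n n ℂ} (hS : S.PosDef)
    (hRS : ∑ i, w i • R i ≤ S) (hZ : ∀ i, (Z i).PosDef) (hZ1 : ∀ i, (Z i).trace.re ≤ 1)
    (hG : G.PosDef) (hG1 : G.trace.re ≤ 1) {s θ : ℝ} (hs : 0 ≤ s) (hs1 : s ≤ 1) (hθ : 0 ≤ θ)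
    (hθ1 : θ ≤ 1) :
    ∑ i, w i * (mpow (Z i) (1 - θ) * (mpow (R i) (s * θ / 2) * mpow S (-(s * θ) / 2) *
      mpow G θ * (mpow S (-(s * θ) / 2) * mpow (R i) (s * θ / 2)))).trace.re ≤ 1 := by
  set f : ℂ → ℂ := fun z => ∑ i, (w i : ℂ) * interpFun (hZ i).isHermitian (hR i).isHermitian
    hS.isHermitian hG.isHermitian s z with hf
  have hfB : StripBounded f := stripBounded_sum _ fun i =>
    (stripBounded_const _).mul (stripBounded_interpFun _ _ _ _ _)
  have h0 : ∀ z ∈ Complex.re ⁻¹' {0}, ‖f z‖ ≤ 1 := by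
    intro y hy
    refine (norm_sum_le _ _).trans (le_trans (Finset.sum_le_sum (g := w) fun i _ => ?_) hw1.le)
    rw [norm_mul, Complex.norm_real, Real.norm_of_nonneg (hw i)]
    exact mul_le_of_le_one_right (hw i)
      ((norm_interpFun_le_of_re_eq_zero (hZ i) _ _ _ _ hy).trans (hZ1 i))
  have h1 : ∀ z ∈ Complex.re ⁻¹' {1}, ‖f z‖ ≤ 1 := by
    intro z hz
    rw [Set.mem_preimage, Set.mem_singleton_iff] at hz
    obtain ⟨y, rfl⟩ : ∃ y, z = 1 + y := ⟨z - 1, by ring⟩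
    replace hz : y.re = 0 := by simpa using hz
    simp only [hf, fun i => interpFun_one_add (hZ i).isHermitian (hR i) hS hG s y]
    exact (norm_sum_trace_le hG.posSemidef hw (sum_smul_relative_le_one hw hw1 hR hS hRS hs hs1)
      (fun i => (isometry_mul (isometry_mul (isometry_cpow _ _ hz) (isometry_cpow _ _ hz))
        (isometry_cpow _ _ hz)).le)
      (by rw [conjTranspose_conjTranspose, mul_eq_one_comm.1 (isometry_cpow _ _ hz)])
      (isometry_mul (isometry_cpow _ _ hz) (isometry_cpow _ _ hz)).le).trans hG1
  have h2 := Complex.HadamardThreeLines.norm_le_interp_of_mem_verticalClosedStrip₀₁' f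
    (z := (θ : ℂ)) (a := 1) (b := 1) (by
      simp [Complex.HadamardThreeLines.verticalClosedStrip, hθ, hθ1]) hfB.1.diffContOnCl (by
      obtain ⟨C, hC⟩ := hfB.2
      refine ⟨C, ?_⟩
      rintro _ ⟨z, hz, rfl⟩
      exact hC z hz.1 hz.2) h0 h1
  rw [Real.one_rpow, Real.one_rpow, mul_one] at h2
  refine le_trans (le_of_eq ?_) ((Complex.re_le_norm _).trans h2)
  simp only [hf, fun i => interpFun_ofReal (hZ i) (hR i) hS hG s θ, Complex.re_sum,
    Complex.re_ofReal_mul]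

end Interpolation

section Core

open scoped MatrixOrder

variable {n : Type*} [Fintype n] [DecidableEq n] {k : ℕ}

omit [Fintype n] [DecidableEq n] in
lemma smul_le_smul_mat {A B : Matrix n n ℂ} (h : A ≤ B) {c : ℝ} (hc : 0 ≤ c) :
    c • A ≤ c • B := by
  rw [Matrix.le_iff] at h ⊢
  rw [← smul_sub]
  exact smul_posSemidef h hc

omit [Fintype n] [DecidableEq n] in
lemma posDef_smul {A : Matrix n n ℂ} (hA : A.PosDef) {c : ℝ} (hc : 0 < c) : (c • A).PosDef := by
  have := hA.smul (a := (c : ℂ)) (by exact_mod_cast hc)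
  simpa using this

omit [Fintype n] in
lemma posDef_add_smul_one {A : Matrix n n ℂ} (hA : A.PosSemidef) {c : ℝ} (hc : 0 < c) :
    (A + c • (1 : Matrix n n ℂ)).PosDef := 
    PosDef.posSemidef_add hA (posDef_smul PosDef.one hc)

omit [DecidableEq n] in
lemma re_trace_smul (A : Matrix n n ℂ) (c : ℝ) : (c • A).trace.re = c * A.trace.re := by
  rw [trace_smul, Complex.smul_re, smul_eq_mul]

/-- Positive semidefinite matrices are dominated by positive definite ones, up to a factor `c`
arbitrarily close to the trace. -/
lemma exists_posDef_le_smul {A : Matrix n n ℂ} (hA : A.PosSemidef) {δ : ℝ} (hδ : 0 < δ) :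
    ∃ B : Matrix n n ℂ, B.PosDef ∧ B.trace.re ≤ 1 ∧ A ≤ (A.trace.re + δ) • B := by
  have ht : 0 ≤ A.trace.re := (Complex.nonneg_iff.1 hA.trace_nonneg).1
  have hc : 0 < A.trace.re + δ := by linarith
  have hd : (0 : ℝ) < Fintype.card n + 1 := by positivity
  refine ⟨(A.trace.re + δ)⁻¹ • (A + (δ / (Fintype.card n + 1)) • (1 : Matrix n n ℂ)),
    posDef_smul (posDef_add_smul_one hA (by positivity)) (by positivity), ?_, ?_⟩
  · rw [re_trace_smul, trace_add, Complex.add_re, re_trace_smul, trace_one, Complex.natCast_re,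
      inv_mul_le_iff₀ hc, mul_one, div_mul_eq_mul_div]
    refine add_le_add le_rfl ?_
    rw [div_le_iff₀ hd]
    nlinarith
  · rw [smul_smul, mul_inv_cancel₀ hc.ne', one_smul]
    exact le_add_of_nonneg_right (smul_posSemidef PosSemidef.one (by positivity)).nonneg

lemma mpow_le_smul_mpow {A B : Matrix n n ℂ} (hA : A.PosSemidef) (hB : B.PosSemidef) {c : ℝ}
    (hc : 0 ≤ c) (h : A ≤ c • B) {s : ℝ} (hs : 0 ≤ s) (hs1 : s ≤ 1) :
    mpow A s ≤ c ^ s • mpow B s := by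
  rw [← mpow_smul hB hc]
  exact mpow_le_mpow hA h hs hs1

/-- A positive semidefinite matrix with trace at most one is replaced by a definite one. -/
lemma exists_posDef_mpow_le {A : Matrix n n ℂ} (hA : A.PosSemidef) (h1 : A.trace.re ≤ 1) :
    ∃ B : Matrix n n ℂ, B.PosDef ∧ B.trace.re ≤ 1 ∧
      ∀ s, 0 ≤ s → s ≤ 1 → mpow A s ≤ (2 : ℝ) • mpow B s := by
  obtain ⟨B, hB, hB1, h⟩ := exists_posDef_le_smul hA one_pos
  have ht : 0 ≤ A.trace.re := (Complex.nonneg_iff.1 hA.trace_nonneg).1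
  refine ⟨B, hB, hB1, fun s hs hs1 => ?_⟩
  refine (mpow_le_smul_mpow hA hB.posSemidef (by linarith) h hs hs1).trans ?_
  rw [Matrix.le_iff, ← sub_smul]
  refine smul_posSemidef (mpow_posSemidef hB.posSemidef _) (sub_nonneg.2 ?_)
  calc (A.trace.re + 1) ^ s ≤ (A.trace.re + 1) ^ (1 : ℝ) :=
        Real.rpow_le_rpow_of_exponent_le (by linarith) hs1
    _ ≤ 2 := by rw [Real.rpow_one]; linarith

/-- Contractivity passes to the adjoint. -/
lemma mul_conjTranspose_le_one {L : Matrix n n ℂ} (h : Lᴴ * L ≤ 1) : L * Lᴴ ≤ 1 := by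
  have hP := posSemidef_self_mul_conjTranspose L
  have h2 : fc (fun t => t ^ 2) (L * Lᴴ) ≤ fc (fun t => t) (L * Lᴴ) := by
    rw [fc_sq hP.isHermitian, fc_id hP.isHermitian]
    have := conj_le_conj h Lᴴ
    rw [mul_one, conjTranspose_conjTranspose] at this
    simpa only [mul_assoc] using this
  have h3 := eigenvalues_le_of_fc_le hP.isHermitian h2
  have h4 := fc_mono hP.isHermitian (f := fun t => t) (g := fun _ => 1) fun i => by
    nlinarith [h3 i]
  rwa [fc_id hP.isHermitian, fc_one hP.isHermitian] at h4

/-- Norming functionals for the Schatten norm of a Hermitian matrix. -/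
lemma exists_norming {X : Matrix n n ℂ} (hX : X.IsHermitian) {p θ : ℝ} (hp : p * (1 + θ) = 2)
    (hθ : 0 ≤ θ) (hθ1 : θ ≤ 1) :
    ∃ z Z : Matrix n n ℂ, z.IsHermitian ∧ Z.PosDef ∧ Z.trace.re ≤ 1 ∧
      z * z ≤ (2 : ℝ) • mpow Z (1 - θ) ∧ trPair z X = hnorm p X := by
  have hp0 : 0 < p := by nlinarith
  have hp1 : 1 ≤ p := by nlinarith
  set T := trFun (fun t => |t| ^ p) X with hT
  have hT0 : 0 ≤ T := trFun_nonneg hX fun t => by positivity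
  rcases hT0.eq_or_lt with h0 | h0
  · obtain ⟨B, hB, hB1, -⟩ := exists_posDef_mpow_le (n := n) PosSemidef.zero (by simp)
    refine ⟨0, B, isHermitian_zero, hB, hB1, ?_, ?_⟩
    · rw [mul_zero]
      exact (smul_posSemidef (mpow_posSemidef hB.posSemidef _) zero_le_two).nonneg
    · rw [map_zero, LinearMap.zero_apply, hnorm, ← hT, ← h0,
        Real.zero_rpow (one_div_ne_zero hp0.ne')]
  · set Z₀ := fc (fun t => T⁻¹ * |t| ^ p) X with hZ₀
    have hZ₀p : Z₀.PosSemidef := fc_nonneg hX fun i => by positivity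
    have hZ₀1 : Z₀.trace.re = 1 := by
      rw [hZ₀, fc_const_mul, re_trace_smul]
      exact inv_mul_cancel₀ h0.ne'
    obtain ⟨Z, hZ, hZ1, h⟩ := exists_posDef_mpow_le hZ₀p hZ₀1.le
    refine ⟨fc (fun t => T ^ (1 / p - 1) * (SignType.sign t * |t| ^ (p - 1))) X, Z,
      isHermitian_fc _ _, hZ, hZ1, ?_, ?_⟩
    · refine le_trans ?_ (h _ (by linarith) (by linarith))
      rw [hZ₀, mpow, fc_comp hX, fc_mul]
      refine fc_mono hX fun i => ?_
      set t := hX.eigenvalues i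
      have e : (1 - θ) = -(1 / p - 1) + -(1 / p - 1) := by
        field_simp; linarith
      have e1 : (T⁻¹ * |t| ^ p) ^ (1 - θ) =
          (T ^ (1 / p - 1) * |t| ^ (p - 1)) * (T ^ (1 / p - 1) * |t| ^ (p - 1)) := by
        rw [Real.mul_rpow (by positivity) (by positivity), ← Real.rpow_neg_one, ← Real.rpow_mul hT0,
          ← Real.rpow_mul (abs_nonneg _)]
        have e2 : T ^ (-1 * (1 - θ)) = T ^ (1 / p - 1) * T ^ (1 / p - 1) := by
          rw [← Real.rpow_add h0]; congr 1; linarith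
        have e3 : |t| ^ (p * (1 - θ)) = |t| ^ (p - 1) * |t| ^ (p - 1) := by
          rw [← Real.rpow_add_of_nonneg (abs_nonneg _) (by linarith) (by linarith)]
          congr 1; linarith
        rw [e2, e3]; ring
      rw [e1]
      have hs : (SignType.sign t : ℝ) * SignType.sign t ≤ 1 := by
        rcases lt_trichotomy t 0 with h | h | h <;> simp [h]
      have hnn : 0 ≤ (T ^ (1 / p - 1) * |t| ^ (p - 1)) * (T ^ (1 / p - 1) * |t| ^ (p - 1)) := by
        positivity
      nlinarith
    · have : trPair (fc (fun t => T ^ (1 / p - 1) * (SignType.sign t * |t| ^ (p - 1))) X)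
          (fc (fun t => t) X) = T ^ (1 / p - 1) * T := by
        rw [trPair_apply, fc_mul, hT, trFun, ← re_trace_smul, ← fc_const_mul]
        congr 2
        refine fc_congr hX fun i => ?_
        set t := hX.eigenvalues i
        have : |t| ^ p = |t| ^ (p - 1) * |t| := by
          rw [← Real.rpow_add_one' (abs_nonneg _) (by linarith)]; congr 1; ring
        simp only [this]
        have h3 : (SignType.sign t : ℝ) * t = |t| := sign_mul_self t
        rw [← h3]; ring
      rw [fc_id hX] at this
      rw [this, hnorm, ← hT, ← Real.rpow_add_one h0.ne']
      congr 1; ring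

/-- The interpolation estimate for positive semidefinite matrices. -/
lemma sum_trPair_mpow_le {w : Fin k → ℝ} (hw : ∀ i, 0 ≤ w i) (hw1 : ∑ i, w i = 1)
    {R Z : Fin k → Matrix n n ℂ} (hR : ∀ i, (R i).PosDef) {S G : Matrix n n ℂ} (hS : S.PosDef)
    (hRS : ∑ i, w i • R i ≤ S) (hZ : ∀ i, (Z i).PosDef) (hZ1 : ∀ i, (Z i).trace.re ≤ 1)
    (hG : G.PosSemidef) {s θ : ℝ} (hs : 0 ≤ s) (hs1 : s ≤ 1) (hθ : 0 ≤ θ)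
    (hθ1 : θ ≤ 1) :
    ∑ i, w i * trPair ((mpow (R i) (s * θ / 2) * mpow S (-(s * θ) / 2))ᴴ *
      mpow (Z i) (1 - θ) * (mpow (R i) (s * θ / 2) * mpow S (-(s * θ) / 2))) (mpow G θ) ≤
      G.trace.re ^ θ := by
  have key : ∀ δ : ℝ, 0 < δ → ∑ i, w i * trPair
      ((mpow (R i) (s * θ / 2) * mpow S (-(s * θ) / 2))ᴴ *
      mpow (Z i) (1 - θ) * (mpow (R i) (s * θ / 2) * mpow S (-(s * θ) / 2))) (mpow G θ) ≤
      (G.trace.re + δ) ^ θ := by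
    intro δ hδ
    have ht : 0 ≤ G.trace.re := (Complex.nonneg_iff.1 hG.trace_nonneg).1
    obtain ⟨B, hB, hB1, h⟩ := exists_posDef_le_smul hG hδ
    have h1 := mpow_le_smul_mpow hG hB.posSemidef (by linarith) h hθ hθ1
    have h2 := sum_re_trace_interpolation_le hw hw1 hR hS hRS hZ hZ1 hB hB1 hs hs1 hθ hθ1
    have h3 := mul_le_mul_of_nonneg_left h2 (Real.rpow_nonneg (add_nonneg ht hδ.le) θ)
    rw [mul_one] at h3
    refine le_trans ?_ h3
    rw [Finset.mul_sum]
    refine Finset.sum_le_sum fun i _ => ?_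
    rw [mul_left_comm]
    refine mul_le_mul_of_nonneg_left ?_ (hw i)
    rw [trPair_comm, trPair_apply]
    refine (re_trace_mul_le h1
      ((mpow_posSemidef (hZ i).posSemidef _).conjTranspose_mul_mul_same _)).trans (le_of_eq ?_)
    rw [Matrix.smul_mul, re_trace_smul, conjTranspose_mul, (mpow_isHermitian _ _).eq,
      (mpow_isHermitian _ _).eq]
    congr 2
    set r := mpow (R i) (s * θ / 2)
    set t := mpow S (-(s * θ) / 2)
    have : mpow B θ * (t * r * mpow (Z i) (1 - θ) * (r * t)) =
        (mpow B θ * (t * r)) * (mpow (Z i) (1 - θ) * (r * t)) := by simp only [mul_assoc]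
    rw [this, trace_mul_comm]
    simp only [mul_assoc]
  have hlim : Filter.Tendsto (fun δ : ℝ => (G.trace.re + δ) ^ θ) (nhdsWithin 0 (Set.Ioi 0))
      (nhds ((G.trace.re + 0) ^ θ)) :=
    (((Real.continuous_rpow_const hθ).comp (continuous_const.add continuous_id)).tendsto
      0).mono_left nhdsWithin_le_nhds
  rw [add_zero] at hlim
  exact ge_of_tendsto hlim (by filter_upwards [self_mem_nhdsWithin] with δ hδ using key δ hδ)

/-- The weighted relative square root of `R` with respect to `S` is a contraction. -/
lemma relative_mul_conjTranspose_le {R S : Matrix n n ℂ} (hR : R.PosDef) (hS : S.PosDef) {w : ℝ}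
    (hw : 0 ≤ w) (h : w • R ≤ S) {κ : ℝ} (hκ : 0 ≤ κ) (hκ1 : κ ≤ 1) :
    w ^ κ • ((mpow R (κ / 2) * mpow S (-κ / 2)) * (mpow R (κ / 2) * mpow S (-κ / 2))ᴴ) ≤ 1 := by
  set K := mpow R (κ / 2) * mpow S (-κ / 2) with hK
  have h1 := mpow_le_mpow (smul_posSemidef hR.posSemidef hw) h hκ hκ1
  rw [mpow_smul hR.posSemidef hw] at h1
  have h2 := conj_le_conj h1 (mpow S (-κ / 2))
  rw [posDef_mpow_neg_conj hS] at h2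
  have e : ∀ c : ℝ, 0 ≤ c → √c * √c = c := fun c hc => Real.mul_self_sqrt hc
  have hwκ : 0 ≤ w ^ κ := Real.rpow_nonneg hw _
  have h3 : (√(w ^ κ) • K)ᴴ * (√(w ^ κ) • K) ≤ 1 := by
    refine le_trans (le_of_eq ?_) h2
    rw [conjTranspose_smul, star_trivial, Matrix.smul_mul, Matrix.mul_smul, smul_smul, e _ hwκ,
      Matrix.mul_smul, Matrix.smul_mul, hK, conjTranspose_mul, (mpow_isHermitian R _).eq,
      mul_assoc, ← mul_assoc (mpow R _), mpow_mul_mpow hR, add_halves, mul_assoc]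
  have h4 := mul_conjTranspose_le_one h3
  rwa [conjTranspose_smul, star_trivial, Matrix.smul_mul, Matrix.mul_smul, smul_smul, e _ hwκ] at h4

/-- The constant in the weighted Khintchine inequality. -/
noncomputable def coreConst (θ : ℝ) : ℝ := if θ < 1 then √(2 * (2 / (1 - θ) - 1) * 2) else 4

/-- A weighted Khintchine inequality for Hermitian matrices. -/
theorem sum_weighted_hnorm_le {w : Fin k → ℝ} (hw : ∀ i, 0 ≤ w i) (hw1 : ∑ i, w i = 1)
    {R x : Fin k → Matrix n n ℂ} (hR : ∀ i, (R i).PosDef) {S : Matrix n n ℂ} (hS : S.PosDef)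
    (hRS : ∑ i, w i • R i ≤ S) (hx : ∀ i, (x i).IsHermitian) {p s θ κ : ℝ} (hs : 0 ≤ s)
    (hs1 : s ≤ 1) (hθ : 0 ≤ θ) (hθ1 : θ ≤ 1) (hp : p * (1 + θ) = 2) (hκ : κ = s * θ) :
    ∑ i, w i ^ ((1 + κ) / 2) * hnorm p (mpow (R i) (κ / 2) * x i * mpow (R i) (κ / 2)) ≤
      coreConst θ *
        √(avg fun ε => hnorm p (mpow S (κ / 2) * rad x ε * mpow S (κ / 2)) ^ 2) := by
  have hκ0 : 0 ≤ κ := hκ ▸ mul_nonneg hs hθ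
  have hκ1 : κ ≤ 1 := hκ ▸ mul_le_one₀ hs1 hθ hθ1
  have herm : ∀ {A B : Matrix n n ℂ}, A.IsHermitian → B.IsHermitian → (A * B * A).IsHermitian :=
    fun {A B} hA hB => by
      rw [IsHermitian, conjTranspose_mul, conjTranspose_mul, hA.eq, hB.eq, mul_assoc]
  choose z Z hz hZ hZ1 hzZ hzx using fun i => exists_norming
    (herm (mpow_isHermitian (R i) (κ / 2)) (hx i)) hp hθ hθ1
  set K := fun i => mpow (R i) (κ / 2) * mpow S (-κ / 2) with hK
  set y := fun i => w i ^ ((1 + κ) / 2) • ((K i)ᴴ * z i * K i) with hy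
  set X := fun i => mpow S (κ / 2) * x i * mpow S (κ / 2) with hX
  have hyH : ∀ i, (y i).IsHermitian := fun i => by
    simp only [hy, IsHermitian, conjTranspose_smul, star_trivial, conjTranspose_mul,
      conjTranspose_conjTranspose, (hz i).eq, mul_assoc]
  have hXH : ∀ i, (X i).IsHermitian := fun i => herm (mpow_isHermitian _ _) (hx i)
  have hrad : ∀ ε, rad X ε = mpow S (κ / 2) * rad x ε * mpow S (κ / 2) := fun ε => by
    simp only [rad, hX, Matrix.mul_sum, Matrix.sum_mul, Matrix.mul_smul, Matrix.smul_mul]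
  have inv1 : mpow S (-κ / 2) * mpow S (κ / 2) = 1 := by
    rw [mpow_mul_mpow hS]
    have : -κ / 2 + κ / 2 = 0 := by ring
    rw [this, mpow_zero hS.isHermitian]
  have inv2 : mpow S (κ / 2) * mpow S (-κ / 2) = 1 := mul_eq_one_comm.1 inv1
  have hyX : ∀ i, trPair (y i) (X i) =
      w i ^ ((1 + κ) / 2) * hnorm p (mpow (R i) (κ / 2) * x i * mpow (R i) (κ / 2)) := by
    intro i
    rw [← hzx i]
    simp only [hy, hX, hK]
    rw [map_smul, LinearMap.smul_apply, smul_eq_mul, trPair_apply, trPair_apply, conjTranspose_mul,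
      (mpow_isHermitian S _).eq, (mpow_isHermitian (R i) _).eq]
    congr 2
    set a := mpow S (-κ / 2)
    set b := mpow S (κ / 2)
    set r := mpow (R i) (κ / 2)
    calc (a * r * z i * (r * a) * (b * x i * b)).trace
        = (a * (r * z i * r * (a * b) * x i * b)).trace := by simp only [mul_assoc]
      _ = (r * (z i * r * x i * (b * a))).trace := by
          rw [trace_mul_comm, inv1, mul_one]; simp only [mul_assoc]
      _ = (z i * (r * x i * r)).trace := by
          rw [trace_mul_comm, inv2, mul_one]; simp only [mul_assoc]
  have hRSi : ∀ i, w i • R i ≤ S := fun i => le_trans (Finset.single_le_sum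
    (f := fun i => w i • R i) (fun j _ => (smul_posSemidef (hR j).posSemidef (hw j)).nonneg)
    (Finset.mem_univ i)) hRS
  have hy2 : ∀ i, y i * y i ≤ (2 * w i) • ((K i)ᴴ * mpow (Z i) (1 - θ) * K i) := by
    intro i
    have h1 := relative_mul_conjTranspose_le (hR i) hS (hw i) (hRSi i) hκ0 hκ1
    have h2 := smul_le_smul_mat (conj_le_conj h1 (z i * K i)) (hw i)
    have h3 := smul_le_smul_mat (conj_le_conj (hzZ i) (K i)) (hw i)
    have e1 : y i * y i = w i • ((z i * K i)ᴴ * (w i ^ κ • (K i * (K i)ᴴ)) * (z i * K i)) := by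
      have : w i ^ ((1 + κ) / 2) * w i ^ ((1 + κ) / 2) = w i * w i ^ κ := by
        rw [← Real.rpow_add_of_nonneg (hw i) (by linarith) (by linarith), add_halves,
          Real.rpow_one_add' (hw i) (by linarith)]
      simp only [hy, Matrix.smul_mul, Matrix.mul_smul, smul_smul, this, conjTranspose_mul,
        (hz i).eq, mul_assoc]
    have e2 : w i • ((z i * K i)ᴴ * 1 * (z i * K i)) = w i • ((K i)ᴴ * (z i * z i) * K i) := by
      simp only [conjTranspose_mul, (hz i).eq, mul_assoc, one_mul]
    have e3 : w i • ((K i)ᴴ * ((2 : ℝ) • mpow (Z i) (1 - θ)) * K i) =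
        (2 * w i) • ((K i)ᴴ * mpow (Z i) (1 - θ) * K i) := by
      rw [Matrix.mul_smul, Matrix.smul_mul, smul_smul, mul_comm]
    rw [e1]
    exact h2.trans ((le_of_eq e2).trans (h3.trans (le_of_eq e3)))
  simp only [← hrad, ← hyX]
  rcases hθ1.lt_or_eq with h | rfl
  · rw [coreConst, if_pos h]
    have h1 : 1 - θ ≠ 0 := by linarith
    refine sum_trPair_le_of_lt_one hyH hXH hθ h zero_le_two (by field_simp) hp fun G hG => ?_
    have h2 := sum_trPair_mpow_le hw hw1 hR hS hRS hZ hZ1 hG hs hs1 hθ hθ1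
    rw [← hκ] at h2
    refine le_trans ?_ (mul_le_mul_of_nonneg_left h2 zero_le_two)
    rw [Finset.mul_sum]
    refine Finset.sum_le_sum fun i _ => ?_
    refine (re_trace_mul_le (hy2 i) (mpow_posSemidef hG _)).trans (le_of_eq ?_)
    rw [Matrix.smul_mul, re_trace_smul, trPair_apply, mul_assoc]
  · rw [coreConst, if_neg (lt_irrefl _)]
    obtain rfl : p = 1 := by linarith
    obtain rfl : κ = s := by rw [hκ, mul_one]
    have h1 := sum_smul_relative_le_one hw hw1 hR hS hRS hs hs1
    have h2 : ∑ i, y i * y i ≤ (2 : ℝ) • 1 := by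
      refine le_trans (Finset.sum_le_sum fun i _ => hy2 i) ?_
      refine le_trans (le_of_eq ?_) (smul_le_smul_mat h1 zero_le_two)
      simp only [sub_self, mpow_zero (hZ _).isHermitian, mul_one, Finset.smul_sum, smul_smul, hK]
    have h3 : ∑ i, ((1 / 2 : ℝ) • y i) * ((1 / 2 : ℝ) • y i) ≤ 1 := by
      have h4 := smul_le_smul_mat h2 (c := 1 / 4) (by norm_num)
      have h5 : ((1 / 4 : ℝ) • (2 : ℝ) • (1 : Matrix n n ℂ)) ≤ 1 := by
        rw [Matrix.le_iff]
        have : (1 : Matrix n n ℂ) - (1 / 4 : ℝ) • (2 : ℝ) • (1 : Matrix n n ℂ) =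
            (1 / 2 : ℝ) • 1 := by module
        rw [this]
        exact smul_posSemidef PosSemidef.one (by norm_num)
      refine le_trans (le_of_eq ?_) (h4.trans h5)
      rw [Finset.smul_sum]
      refine Finset.sum_congr rfl fun i _ => ?_
      rw [Matrix.smul_mul, Matrix.mul_smul, smul_smul]
      norm_num
    have h4 := sum_trPair_le_of_sum_sq_le_one hXH (y := fun i => (1 / 2 : ℝ) • y i) (fun i => by
      rw [IsHermitian, conjTranspose_smul, star_trivial, (hyH i).eq]) h3
    simp only [map_smul, LinearMap.smul_apply, smul_eq_mul, ← Finset.mul_sum] at h4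
    have h5 := avg_cauchy_schwarz (fun ε => hnorm 1 (rad X ε)) (fun _ => 1)
    simp only [mul_one, one_pow, avg_const, Real.sqrt_one] at h5
    linarith

end Core

section Transfer

open scoped MatrixOrder

variable {m n : Type*} [Fintype m] [DecidableEq m] [Fintype n] [DecidableEq n]

lemma fc_eq_aeval {A : Matrix n n ℂ} (hA : A.IsHermitian) {f : ℝ → ℝ} {P : Polynomial ℝ}
    (h : ∀ i, f (hA.eigenvalues i) = P.eval (hA.eigenvalues i)) :
    fc f A = Polynomial.aeval A P := by
  rw [fc_congr hA (g := fun t => P.eval t) h]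
  exact cfc_polynomial P A hA

lemma exists_polynomial_eqOn (f : ℝ → ℝ) (s : Finset ℝ) :
    ∃ P : Polynomial ℝ, ∀ t ∈ s, f t = P.eval t :=
  ⟨Lagrange.interpolate s id f, fun _ ht =>
    (Lagrange.eval_interpolate_at_node f (v := id) (fun _ _ _ _ h => h) ht).symm⟩

lemma fc_kronecker_one {A : Matrix n n ℂ} (hA : A.IsHermitian) (f : ℝ → ℝ) :
    fc f (A ⊗ₖ (1 : Matrix m m ℂ)) = fc f A ⊗ₖ (1 : Matrix m m ℂ) := by
  have hA' : (A ⊗ₖ (1 : Matrix m m ℂ)).IsHermitian := by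
    rw [IsHermitian, conjTranspose_kronecker, hA.eq, conjTranspose_one]
  obtain ⟨P, hP⟩ := exists_polynomial_eqOn f
    (Finset.univ.image hA.eigenvalues ∪ Finset.univ.image hA'.eigenvalues)
  rw [fc_eq_aeval hA (P := P) fun i => hP _ (by simp),
    fc_eq_aeval hA' (P := P) fun i => hP _ (by simp)]
  have hpow : ∀ j : ℕ, (A ⊗ₖ (1 : Matrix m m ℂ)) ^ j = (A ^ j) ⊗ₖ (1 : Matrix m m ℂ) := by
    intro j
    induction j with
    | zero => simp
    | succ j ih => rw [pow_succ, ih, ← mul_kronecker_mul, one_mul, pow_succ]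
  rw [Polynomial.aeval_eq_sum_range, Polynomial.aeval_eq_sum_range]
  ext i j
  simp [hpow, Matrix.sum_apply, Finset.sum_mul, mul_assoc]

lemma fc_fromBlocks {A : Matrix m m ℂ} {B : Matrix n n ℂ} (hA : A.IsHermitian)
    (hB : B.IsHermitian) (f : ℝ → ℝ) :
    fc f (fromBlocks A 0 0 B) = fromBlocks (fc f A) 0 0 (fc f B) := by
  have h : (fromBlocks A 0 0 B).IsHermitian := by
    rw [IsHermitian, fromBlocks_conjTranspose, hA.eq, hB.eq, conjTranspose_zero, conjTranspose_zero]
  obtain ⟨P, hP⟩ := exists_polynomial_eqOn f (Finset.univ.image hA.eigenvalues ∪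
    (Finset.univ.image hB.eigenvalues ∪ Finset.univ.image h.eigenvalues))
  rw [fc_eq_aeval hA (P := P) fun i => hP _ (by simp),
    fc_eq_aeval hB (P := P) fun i => hP _ (by simp),
    fc_eq_aeval h (P := P) fun i => hP _ (by simp)]
  simp only [Polynomial.aeval_eq_sum_range, fromBlocks_diagonal_pow]
  ext (i | i) (j | j) <;> simp [Matrix.sum_apply]

lemma posDef_fromBlocks {A : Matrix m m ℂ} {B : Matrix n n ℂ} (hA : A.PosDef) (hB : B.PosDef) :
    (fromBlocks A 0 0 B).PosDef := by
  have h : (fromBlocks A 0 0 B).PosSemidef := by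
    have := hA.isUnit.invertible
    have h := (PosDef.fromBlocks₁₁ (0 : Matrix m n ℂ) B hA).2 (by simpa using hB.posSemidef)
    rwa [conjTranspose_zero] at h
  rw [h.posDef_iff_isUnit, isUnit_iff_isUnit_det, det_fromBlocks_zero₂₁]
  exact ((isUnit_iff_isUnit_det _).1 hA.isUnit).mul ((isUnit_iff_isUnit_det _).1 hB.isUnit)

omit [DecidableEq n] in
lemma kronecker_one_le {A B : Matrix n n ℂ} (h : A ≤ B) :
    A ⊗ₖ (1 : Matrix m m ℂ) ≤ B ⊗ₖ (1 : Matrix m m ℂ) := by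
  have := (Matrix.le_iff.1 h).kronecker (PosSemidef.one (n := m) (R := ℂ))
  rw [Matrix.le_iff]
  have e : B ⊗ₖ (1 : Matrix m m ℂ) - A ⊗ₖ (1 : Matrix m m ℂ) = (B - A) ⊗ₖ (1 : Matrix m m ℂ) := by
    ext i j
    simp [sub_mul]
  rwa [e]

/-- The Schatten `p`-norm of a square matrix for finite `p`. -/
noncomputable def snorm (p : ℝ) (X : Matrix n n ℂ) : ℝ :=
  (mpow (Xᴴ * X) (p / 2)).trace.re ^ (1 / p)

lemma schNorm_ofReal {p : ℝ} (hp : 0 < p) (X : Matrix n n ℂ) :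
    schNorm (ENNReal.ofReal p) X = snorm p X := by
  rw [schNorm, if_neg ENNReal.ofReal_ne_top, ENNReal.toReal_ofReal hp.le, snorm, mpow,
    re_trace_fc (posSemidef_conjTranspose_mul_self X).isHermitian]
  rfl

lemma re_trace_mpow_nonneg {A : Matrix n n ℂ} (hA : A.PosSemidef) (s : ℝ) :
    0 ≤ (mpow A s).trace.re := (Complex.nonneg_iff.1 (mpow_posSemidef hA s).trace_nonneg).1

lemma snorm_nonneg (p : ℝ) (X : Matrix n n ℂ) : 0 ≤ snorm p X :=
  Real.rpow_nonneg (re_trace_mpow_nonneg (posSemidef_conjTranspose_mul_self X) _) _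

lemma re_trace_mpow_conjTranspose (X : Matrix n n ℂ) (s : ℝ) :
    (mpow (X * Xᴴ) s).trace.re = (mpow (Xᴴ * X) s).trace.re := by
  rw [mpow, mpow, re_trace_fc (posSemidef_self_mul_conjTranspose X).isHermitian,
    re_trace_fc (posSemidef_conjTranspose_mul_self X).isHermitian]
  exact trace_fc_eq_of_charpoly (posSemidef_self_mul_conjTranspose X).isHermitian
    (posSemidef_conjTranspose_mul_self X).isHermitian (Matrix.charpoly_mul_comm _ _)
    fun t => t ^ s

lemma snorm_mono {p : ℝ} (hp : 0 < p) (hp2 : p ≤ 2) {a b c d x : Matrix n n ℂ}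
    (h1 : aᴴ * a ≤ cᴴ * c) (h2 : b * bᴴ ≤ d * dᴴ) : snorm p (a * x * b) ≤ snorm p (c * x * d) := by
  have left : ∀ (a c y : Matrix n n ℂ), aᴴ * a ≤ cᴴ * c →
      (mpow ((a * y)ᴴ * (a * y)) (p / 2)).trace.re ≤
        (mpow ((c * y)ᴴ * (c * y)) (p / 2)).trace.re := by
    intro a c y h
    refine re_trace_le (mpow_le_mpow (posSemidef_conjTranspose_mul_self _) ?_ (by positivity)
      (by linarith))
    have := conj_le_conj h y
    simpa only [conjTranspose_mul, mul_assoc] using this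
  have right : ∀ {b d y : Matrix n n ℂ}, b * bᴴ ≤ d * dᴴ →
      (mpow ((y * b)ᴴ * (y * b)) (p / 2)).trace.re ≤
        (mpow ((y * d)ᴴ * (y * d)) (p / 2)).trace.re := by
    intro b d y h
    have h1 := left bᴴ dᴴ yᴴ (by simpa only [conjTranspose_conjTranspose] using h)
    rw [← conjTranspose_mul y b, ← conjTranspose_mul y d, conjTranspose_conjTranspose,
      conjTranspose_conjTranspose] at h1
    rwa [re_trace_mpow_conjTranspose, re_trace_mpow_conjTranspose] at h1
  refine Real.rpow_le_rpow (re_trace_mpow_nonneg (posSemidef_conjTranspose_mul_self _) _) ?_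
    (by positivity)
  refine (right h2).trans ?_
  rw [mul_assoc, mul_assoc]
  exact left _ _ _ h1

lemma snorm_smul {p : ℝ} (hp : 0 < p) {c : ℝ} (hc : 0 ≤ c) (X : Matrix n n ℂ) :
    snorm p (c • X) = c * snorm p X := by
  have h := posSemidef_conjTranspose_mul_self X
  rw [snorm, conjTranspose_smul, star_trivial, Matrix.smul_mul, Matrix.mul_smul, smul_smul,
    mpow_smul h (by positivity), re_trace_smul,
    Real.mul_rpow (by positivity) (re_trace_mpow_nonneg h _), snorm,
    ← Real.rpow_mul (by positivity), ← sq, ← Real.rpow_natCast, ← Real.rpow_mul hc]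
  congr 1
  rw [show ((2 : ℕ) : ℝ) * (p / 2 * (1 / p)) = 1 by push_cast; field_simp, Real.rpow_one]

/-- The Hermitian dilation of a matrix. -/
def dilation (X : Matrix n n ℂ) : Matrix (n ⊕ n) (n ⊕ n) ℂ := fromBlocks 0 X Xᴴ 0

omit [Fintype n] [DecidableEq n] in
lemma isHermitian_dilation (X : Matrix n n ℂ) : (dilation X).IsHermitian := by
  rw [dilation, IsHermitian, fromBlocks_conjTranspose]
  simp

omit [DecidableEq m] [DecidableEq n] in
lemma trace_fromBlocks_diag (A : Matrix m m ℂ) (B : Matrix n n ℂ) :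
    (fromBlocks A 0 0 B).trace = A.trace + B.trace := by
  simp [trace]

lemma hnorm_dilation (p : ℝ) (X : Matrix n n ℂ) :
    hnorm p (dilation X) = 2 ^ (1 / p) * snorm p X := by
  have hH := isHermitian_dilation X
  have e : dilation X * dilation X = fromBlocks (X * Xᴴ) 0 0 (Xᴴ * X) := by
    rw [dilation, fromBlocks_multiply]
    simp
  have h1 : fc (fun t => |t| ^ p) (dilation X) = mpow (dilation X * dilation X) (p / 2) := by
    rw [← fc_sq hH, mpow, fc_comp hH]
    refine fc_congr hH fun i => ?_
    rw [← sq_abs, ← Real.rpow_natCast, ← Real.rpow_mul (abs_nonneg _)]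
    congr 1
    push_cast
    ring
  rw [hnorm, trFun, h1, e, mpow, fc_fromBlocks (posSemidef_self_mul_conjTranspose X).isHermitian
    (posSemidef_conjTranspose_mul_self X).isHermitian, trace_fromBlocks_diag, Complex.add_re,
    ← mpow, ← mpow, re_trace_mpow_conjTranspose, ← two_mul, Real.mul_rpow zero_le_two
    (re_trace_mpow_nonneg (posSemidef_conjTranspose_mul_self X) _), snorm]

lemma mpow_fromBlocks_mul_dilation_mul {P Q : Matrix n n ℂ} (hP : P.IsHermitian)
    (hQ : Q.IsHermitian) (x : Matrix n n ℂ) (s : ℝ) :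
    mpow (fromBlocks P 0 0 Q) s * dilation x * mpow (fromBlocks P 0 0 Q) s =
      dilation (mpow P s * x * mpow Q s) := by
  rw [mpow, fc_fromBlocks hP hQ, ← mpow, ← mpow, dilation, dilation, fromBlocks_multiply,
    fromBlocks_multiply]
  simp only [conjTranspose_mul, (mpow_isHermitian P s).eq, (mpow_isHermitian Q s).eq]
  simp [mul_assoc]

omit [Fintype n] [DecidableEq n] in
lemma rad_dilation {k : ℕ} (x : Fin k → Matrix n n ℂ) (ε : Fin k → Bool) :
    rad (fun i => dilation (x i)) ε = dilation (rad x ε) := by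
  ext (i | i) (j | j) <;> simp [rad, dilation, Matrix.sum_apply]

/-- A weighted Khintchine inequality for arbitrary square matrices. -/
theorem sum_weighted_snorm_le {k : ℕ} {w : Fin k → ℝ} (hw : ∀ i, 0 ≤ w i) (hw1 : ∑ i, w i = 1)
    {P Q : Fin k → Matrix n n ℂ} (x : Fin k → Matrix n n ℂ) (hP : ∀ i, (P i).PosDef)
    (hQ : ∀ i, (Q i).PosDef) {S T : Matrix n n ℂ} (hS : S.PosDef) (hT : T.PosDef)
    (hPS : ∑ i, w i • P i = S) (hQT : ∑ i, w i • Q i = T) {p s θ κ : ℝ} (hs : 0 ≤ s)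
    (hs1 : s ≤ 1) (hθ : 0 ≤ θ) (hθ1 : θ ≤ 1) (hp : p * (1 + θ) = 2) (hκ : κ = s * θ) :
    ∑ i, w i ^ ((1 + κ) / 2) * snorm p (mpow (P i) (κ / 2) * x i * mpow (Q i) (κ / 2)) ≤
      coreConst θ *
        √(avg fun ε => snorm p (mpow S (κ / 2) * rad x ε * mpow T (κ / 2)) ^ 2) := by
  have hsum : ∑ i, w i • fromBlocks (P i) 0 0 (Q i) = fromBlocks S 0 0 T := by
    rw [← hPS, ← hQT]
    ext (i | i) (j | j) <;> simp [Matrix.sum_apply]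
  have h := sum_weighted_hnorm_le hw hw1 (fun i => posDef_fromBlocks (hP i) (hQ i))
    (posDef_fromBlocks hS hT) hsum.le (fun i => isHermitian_dilation (x i)) hs hs1 hθ hθ1 hp hκ
  simp only [mpow_fromBlocks_mul_dilation_mul hS.isHermitian hT.isHermitian,
    mpow_fromBlocks_mul_dilation_mul (hP _).isHermitian (hQ _).isHermitian, rad_dilation,
    hnorm_dilation, mul_pow, mul_left_comm _ ((2 : ℝ) ^ (1 / p)), ← Finset.mul_sum] at h
  have h2 := avg_smul (((2 : ℝ) ^ (1 / p)) ^ 2) fun ε =>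
    snorm p (mpow S (κ / 2) * rad x ε * mpow T (κ / 2)) ^ 2
  simp only [smul_eq_mul] at h2
  rw [h2, Real.sqrt_mul (by positivity), Real.sqrt_sq (by positivity),
    mul_left_comm (coreConst θ)] at h
  exact le_of_mul_le_mul_left h (by positivity)

end Transfer

section VectorValued

open scoped MatrixOrder

variable {n : Type*} [Fintype n] [DecidableEq n]

/-- The exponent of the multipliers in the factorization formula. -/
noncomputable def multExp (q p : ℝ) : ℝ≥0∞ :=
  if p = q then ∞ else ENNReal.ofReal (2 * p * q / (q - p))

lemma rpow_le_one_iff_of_nonneg {x z : ℝ} (hx : 0 ≤ x) (hz : 0 < z) : x ^ z ≤ 1 ↔ x ≤ 1 := by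
  rw [← Real.rpow_le_rpow_iff hx zero_le_one hz, Real.one_rpow]

lemma conjTranspose_mul_self_le_one_of_ctmEig {a : Matrix n n ℂ} (h : ∀ j, ctmEig a j ≤ 1) :
    aᴴ * a ≤ 1 := by
  have hP := posSemidef_conjTranspose_mul_self a
  have := fc_mono hP.isHermitian (f := fun t => t) (g := fun _ => 1) h
  rwa [fc_id hP.isHermitian, fc_one hP.isHermitian] at this

lemma ctmEig_nonneg (a : Matrix n n ℂ) (j : n) : 0 ≤ ctmEig a j :=
  (posSemidef_conjTranspose_mul_self a).eigenvalues_nonneg j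

lemma ctmEig_le_one {a : Matrix n n ℂ} (h : aᴴ * a ≤ 1) (j : n) : ctmEig a j ≤ 1 := by
  have hP := posSemidef_conjTranspose_mul_self a
  rw [← fc_one hP.isHermitian] at h
  nth_rw 1 [← fc_id hP.isHermitian] at h
  exact eigenvalues_le_of_fc_le hP.isHermitian h j

lemma schNorm_top_le_one_iff {a : Matrix n n ℂ} : schNorm ∞ a ≤ 1 ↔ aᴴ * a ≤ 1 := by
  rw [schNorm, if_pos rfl]
  refine ⟨fun h => conjTranspose_mul_self_le_one_of_ctmEig fun j => ?_, fun h => ?_⟩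
  · have h1 := (le_ciSup (Set.finite_range fun j => √(ctmEig a j)).bddAbove j).trans h
    exact (Real.sqrt_le_one.1 h1)
  · exact Real.iSup_le (fun j => Real.sqrt_le_one.2 (ctmEig_le_one h j)) zero_le_one

/-- The exponents `1 ≤ p ≤ q` with their defect `κ = 1 / p - 1 / q`. -/
structure Exponents (q p κ : ℝ) : Prop where
  one_le : 1 ≤ p
  le : p ≤ q
  eq : κ = 1 / p - 1 / q

variable {q p κ : ℝ}

lemma Exponents.multExp_of_eq_zero (h : Exponents q p κ) (h0 : κ = 0) : multExp q p = ∞ := by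
  have h1 := h.one_le
  have h2 := h.le
  have h3 : 1 / p = 1 / q := by linarith [h.eq]
  have h4 : p = q := by
    rw [one_div, one_div] at h3
    exact inv_injective h3
  rw [multExp, if_pos h4]

lemma Exponents.nonneg (h : Exponents q p κ) : 0 ≤ κ := by
  have h1 := h.one_le
  rw [h.eq, sub_nonneg]
  exact one_div_le_one_div_of_le (by linarith) h.le

lemma Exponents.lt_one (h : Exponents q p κ) : κ < 1 := by
  have h1 := h.one_le
  have h2 := h.le
  have h3 : 1 / p ≤ 1 := (div_le_one (by linarith)).2 h1
  have h4 : 0 < 1 / q := one_div_pos.2 (by linarith)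
  linarith [h.eq]

lemma Exponents.multExp_of_pos (h : Exponents q p κ) (h0 : 0 < κ) :
    multExp q p = ENNReal.ofReal (2 / κ) := by
  have h1 := h.one_le
  have h2 := h.le
  have h3 : p ≠ q := by
    rintro rfl
    linarith [h.eq]
  have h4 : q - p ≠ 0 := sub_ne_zero.2 h3.symm
  rw [multExp, if_neg h3, h.eq]
  congr 1
  have h5 : p ≠ 0 := by linarith
  have h6 : q ≠ 0 := by linarith
  field_simp

lemma snorm_le_one_iff {t : ℝ} (ht : 0 < t) (a : Matrix n n ℂ) :
    snorm t a ≤ 1 ↔ (mpow (aᴴ * a) (t / 2)).trace.re ≤ 1 := by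
  rw [snorm]
  exact rpow_le_one_iff_of_nonneg (re_trace_mpow_nonneg (posSemidef_conjTranspose_mul_self a) _)
    (by positivity)

lemma Exponents.schNorm_le_one_iff (h : Exponents q p κ) (h0 : 0 < κ) (a : Matrix n n ℂ) :
    schNorm (multExp q p) a ≤ 1 ↔ (mpow (aᴴ * a) (1 / κ)).trace.re ≤ 1 := by
  rw [h.multExp_of_pos h0, schNorm_ofReal (by positivity), snorm_le_one_iff (by positivity)]
  rw [show 2 / κ / 2 = 1 / κ by field_simp]

lemma Exponents.schNorm_conjTranspose_le_one (h : Exponents q p κ) {a : Matrix n n ℂ}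
    (ha : schNorm (multExp q p) a ≤ 1) : schNorm (multExp q p) aᴴ ≤ 1 := by
  rcases h.nonneg.eq_or_lt with h0 | h0
  · rw [h.multExp_of_eq_zero h0.symm, schNorm_top_le_one_iff] at ha ⊢
    rw [conjTranspose_conjTranspose]
    exact mul_conjTranspose_le_one ha
  · rw [h.schNorm_le_one_iff h0] at ha ⊢
    rwa [conjTranspose_conjTranspose, re_trace_mpow_conjTranspose]

lemma Exponents.conjTranspose_mul_self_le_one (h : Exponents q p κ) {a : Matrix n n ℂ}
    (ha : schNorm (multExp q p) a ≤ 1) : aᴴ * a ≤ 1 := by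
  rcases h.nonneg.eq_or_lt with h0 | h0
  · rwa [h.multExp_of_eq_zero h0.symm, schNorm_top_le_one_iff] at ha
  · rw [h.schNorm_le_one_iff h0, mpow,
      re_trace_fc (posSemidef_conjTranspose_mul_self a).isHermitian] at ha
    refine conjTranspose_mul_self_le_one_of_ctmEig fun j => ?_
    have h1 : ctmEig a j ^ (1 / κ) ≤ 1 := (Finset.single_le_sum
      (f := fun j => ctmEig a j ^ (1 / κ)) (fun i _ => Real.rpow_nonneg (ctmEig_nonneg a i) _)
      (Finset.mem_univ j)).trans ha
    exact (rpow_le_one_iff_of_nonneg (ctmEig_nonneg a j) (by positivity)).1 h1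

lemma Exponents.exists_density (h : Exponents q p κ) {a : Matrix n n ℂ}
    (ha : schNorm (multExp q p) a ≤ 1) :
    ∃ ρ : Matrix n n ℂ, ρ.PosDef ∧ ρ.trace.re ≤ 1 ∧ aᴴ * a ≤ (2 : ℝ) • mpow ρ κ := by
  have hP := posSemidef_conjTranspose_mul_self a
  rcases h.nonneg.eq_or_lt with h0 | h0
  · obtain ⟨ρ, hρ, hρ1, -⟩ := exists_posDef_mpow_le (n := n) PosSemidef.zero (by simp)
    refine ⟨ρ, hρ, hρ1, ?_⟩
    rw [← h0, mpow_zero hρ.isHermitian, two_smul]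
    exact (h.conjTranspose_mul_self_le_one ha).trans
      (le_add_of_nonneg_right PosSemidef.one.nonneg)
  · rw [h.schNorm_le_one_iff h0] at ha
    obtain ⟨ρ, hρ, hρ1, h1⟩ := exists_posDef_mpow_le (mpow_posSemidef hP (1 / κ)) ha
    refine ⟨ρ, hρ, hρ1, ?_⟩
    have h2 := h1 κ h0.le h.lt_one.le
    rwa [mpow_mpow hP, one_div_mul_cancel h0.ne', mpow_one hP.isHermitian] at h2

lemma Exponents.schNorm_mpow_le_one (h : Exponents q p κ) {ρ : Matrix n n ℂ} (hρ : ρ.PosDef)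
    (hρ1 : ρ.trace.re ≤ 1) : schNorm (multExp q p) (mpow ρ (κ / 2)) ≤ 1 := by
  have e : (mpow ρ (κ / 2))ᴴ * mpow ρ (κ / 2) = mpow ρ κ := by
    rw [(mpow_isHermitian ρ _).eq, mpow_mul_mpow hρ, add_halves]
  rcases h.nonneg.eq_or_lt with h0 | h0
  · rw [h.multExp_of_eq_zero h0.symm, schNorm_top_le_one_iff, e, ← h0, mpow_zero hρ.isHermitian]
  · rw [h.schNorm_le_one_iff h0, e, mpow_mpow hρ.posSemidef, mul_one_div_cancel h0.ne',
      mpow_one hρ.isHermitian]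
    exact hρ1

/-- The set whose supremum is the norm of `S_q(S_p)`. -/
def normSet (q p : ℝ) {N M : ℕ} (x : Matrix (Fin N × Fin M) (Fin N × Fin M) ℂ) : Set ℝ :=
  {c : ℝ | ∃ a b : Matrix (Fin N) (Fin N) ℂ,
    schNorm (multExp q p) a ≤ 1 ∧ schNorm (multExp q p) b ≤ 1 ∧
    c = schNorm (ENNReal.ofReal p)
          ((a ⊗ₖ (1 : Matrix (Fin M) (Fin M) ℂ)) * x * (b ⊗ₖ (1 : Matrix (Fin M) (Fin M) ℂ)))}

variable {N M : ℕ}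

lemma sqSpNorm_eq (q p : ℝ) (x : Matrix (Fin N × Fin M) (Fin N × Fin M) ℂ) :
    sqSpNorm q p x = sSup (normSet q p x) := rfl

lemma kronecker_one_conjTranspose_mul (a : Matrix (Fin N) (Fin N) ℂ) :
    (a ⊗ₖ (1 : Matrix (Fin M) (Fin M) ℂ))ᴴ * (a ⊗ₖ (1 : Matrix (Fin M) (Fin M) ℂ)) =
      (aᴴ * a) ⊗ₖ (1 : Matrix (Fin M) (Fin M) ℂ) := by
  rw [conjTranspose_kronecker, conjTranspose_one, ← mul_kronecker_mul, one_mul]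

lemma kronecker_one_mul_conjTranspose (a : Matrix (Fin N) (Fin N) ℂ) :
    (a ⊗ₖ (1 : Matrix (Fin M) (Fin M) ℂ)) * (a ⊗ₖ (1 : Matrix (Fin M) (Fin M) ℂ))ᴴ =
      (a * aᴴ) ⊗ₖ (1 : Matrix (Fin M) (Fin M) ℂ) := by
  rw [conjTranspose_kronecker, conjTranspose_one, ← mul_kronecker_mul, one_mul]

lemma Exponents.bddAbove_normSet (h : Exponents q p κ) (hp2 : p ≤ 2)
    (x : Matrix (Fin N × Fin M) (Fin N × Fin M) ℂ) : BddAbove (normSet q p x) := by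
  have hp := h.one_le
  refine ⟨snorm p (1 * x * 1), ?_⟩
  rintro _ ⟨a, b, ha, hb, rfl⟩
  rw [schNorm_ofReal (by linarith)]
  have h1 := h.conjTranspose_mul_self_le_one ha
  have h2 := mul_conjTranspose_le_one (h.conjTranspose_mul_self_le_one hb)
  refine snorm_mono (by linarith) hp2 ?_ ?_
  · rw [kronecker_one_conjTranspose_mul, conjTranspose_one, one_mul]
    exact (kronecker_one_le h1).trans (one_kronecker_one (α := ℂ)).le
  · rw [kronecker_one_mul_conjTranspose, conjTranspose_one, one_mul]
    exact (kronecker_one_le h2).trans (one_kronecker_one (α := ℂ)).le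

lemma Exponents.nonneg_of_mem_normSet (h : Exponents q p κ)
    {x : Matrix (Fin N × Fin M) (Fin N × Fin M) ℂ} {c : ℝ} (hc : c ∈ normSet q p x) : 0 ≤ c := by
  obtain ⟨a, b, -, -, rfl⟩ := hc
  rw [schNorm_ofReal (by linarith [h.one_le])]
  exact snorm_nonneg _ _

lemma Exponents.sqSpNorm_nonneg (h : Exponents q p κ)
    (x : Matrix (Fin N × Fin M) (Fin N × Fin M) ℂ) : 0 ≤ sqSpNorm q p x :=
  Real.sSup_nonneg fun _ hc => h.nonneg_of_mem_normSet hc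

lemma mpow_kronecker_one {ρ : Matrix (Fin N) (Fin N) ℂ} (hρ : ρ.IsHermitian) (s : ℝ) :
    mpow (ρ ⊗ₖ (1 : Matrix (Fin M) (Fin M) ℂ)) s = mpow ρ s ⊗ₖ (1 : Matrix (Fin M) (Fin M) ℂ) :=
  fc_kronecker_one hρ _

lemma Exponents.snorm_le_sqSpNorm (h : Exponents q p κ) (hp2 : p ≤ 2)
    {ρ σ : Matrix (Fin N) (Fin N) ℂ} (hρ : ρ.PosDef) (hρ1 : ρ.trace.re ≤ 1) (hσ : σ.PosDef)
    (hσ1 : σ.trace.re ≤ 1) (x : Matrix (Fin N × Fin M) (Fin N × Fin M) ℂ) :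
    snorm p (mpow (ρ ⊗ₖ (1 : Matrix (Fin M) (Fin M) ℂ)) (κ / 2) * x *
      mpow (σ ⊗ₖ (1 : Matrix (Fin M) (Fin M) ℂ)) (κ / 2)) ≤ sqSpNorm q p x := by
  rw [mpow_kronecker_one hρ.isHermitian, mpow_kronecker_one hσ.isHermitian,
    ← schNorm_ofReal (by linarith [h.one_le])]
  exact le_csSup (h.bddAbove_normSet hp2 x)
    ⟨_, _, h.schNorm_mpow_le_one hρ hρ1, h.schNorm_mpow_le_one hσ hσ1, rfl⟩

/-- The norm of `S_q(S_p)` is attained, up to a constant, at powers of densities. -/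
lemma Exponents.exists_sqSpNorm_le (h : Exponents q p κ) (hp2 : p ≤ 2)
    (x : Matrix (Fin N × Fin M) (Fin N × Fin M) ℂ) :
    ∃ ρ σ : Matrix (Fin N) (Fin N) ℂ, (ρ.PosDef ∧ ρ.trace.re ≤ 1) ∧
      (σ.PosDef ∧ σ.trace.re ≤ 1) ∧
      sqSpNorm q p x ≤ 4 * snorm p (mpow (ρ ⊗ₖ (1 : Matrix (Fin M) (Fin M) ℂ)) (κ / 2) * x *
        mpow (σ ⊗ₖ (1 : Matrix (Fin M) (Fin M) ℂ)) (κ / 2)) := by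
  have hp := h.one_le
  rcases (h.sqSpNorm_nonneg x).eq_or_lt with h0 | h0
  · obtain ⟨ρ, hρ, hρ1, -⟩ := exists_posDef_mpow_le (n := Fin N) PosSemidef.zero (by simp)
    exact ⟨ρ, ρ, ⟨hρ, hρ1⟩, ⟨hρ, hρ1⟩, h0 ▸ mul_nonneg (by norm_num) (snorm_nonneg _ _)⟩
  have hne : (normSet q p x).Nonempty := by
    by_contra! hne
    rw [sqSpNorm_eq, hne, Real.sSup_empty] at h0
    exact lt_irrefl _ h0
  obtain ⟨_, ⟨a, b, ha, hb, rfl⟩, hc⟩ := exists_lt_of_lt_csSup hne (half_lt_self h0)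
  obtain ⟨ρ, hρ, hρ1, h1⟩ := h.exists_density ha
  obtain ⟨σ, hσ, hσ1, h2⟩ := h.exists_density (h.schNorm_conjTranspose_le_one hb)
  refine ⟨ρ, σ, ⟨hρ, hρ1⟩, ⟨hσ, hσ1⟩, ?_⟩
  rw [conjTranspose_conjTranspose] at h2
  rw [schNorm_ofReal (by linarith)] at hc
  have e : ∀ {τ : Matrix (Fin N) (Fin N) ℂ}, τ.PosDef →
      (√2 • mpow τ (κ / 2)) * (√2 • mpow τ (κ / 2)) = (2 : ℝ) • mpow τ κ := fun hτ => by
    rw [Matrix.smul_mul, Matrix.mul_smul, smul_smul, Real.mul_self_sqrt zero_le_two,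
      mpow_mul_mpow hτ, add_halves]
  have he : ∀ τ : Matrix (Fin N) (Fin N) ℂ, (√2 • mpow τ (κ / 2))ᴴ = √2 • mpow τ (κ / 2) :=
    fun τ => by rw [conjTranspose_smul, star_trivial, (mpow_isHermitian τ _).eq]
  have h3 := snorm_mono (p := p) (by linarith) hp2 (x := x)
    (a := a ⊗ₖ (1 : Matrix (Fin M) (Fin M) ℂ)) (b := b ⊗ₖ (1 : Matrix (Fin M) (Fin M) ℂ))
    (c := (√2 • mpow ρ (κ / 2)) ⊗ₖ (1 : Matrix (Fin M) (Fin M) ℂ))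
    (d := (√2 • mpow σ (κ / 2)) ⊗ₖ (1 : Matrix (Fin M) (Fin M) ℂ))
    (by
      rw [kronecker_one_conjTranspose_mul, kronecker_one_conjTranspose_mul, he, e hρ]
      exact kronecker_one_le h1)
    (by
      rw [kronecker_one_mul_conjTranspose, kronecker_one_mul_conjTranspose, he, e hσ]
      exact kronecker_one_le h2)
  rw [mpow_kronecker_one hρ.isHermitian, mpow_kronecker_one hσ.isHermitian]
  have e2 : (√2 • mpow ρ (κ / 2)) ⊗ₖ (1 : Matrix (Fin M) (Fin M) ℂ) * x *
      (√2 • mpow σ (κ / 2)) ⊗ₖ (1 : Matrix (Fin M) (Fin M) ℂ) =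
      (2 : ℝ) • (mpow ρ (κ / 2) ⊗ₖ (1 : Matrix (Fin M) (Fin M) ℂ) * x *
        mpow σ (κ / 2) ⊗ₖ (1 : Matrix (Fin M) (Fin M) ℂ)) := by
    rw [smul_kronecker, smul_kronecker, Matrix.smul_mul, Matrix.smul_mul, Matrix.mul_smul,
      smul_smul, Real.mul_self_sqrt zero_le_two]
  rw [e2, snorm_smul (by linarith) zero_le_two] at h3
  rw [← sqSpNorm_eq] at hc
  linarith

end VectorValued

section Cotype

open scoped MatrixOrder

lemma posDef_weighted_sum {n : Type*} [Fintype n] [DecidableEq n] {k : ℕ} {w : Fin k → ℝ}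
    (hw : ∀ i, 0 ≤ w i) (hw1 : ∑ i, w i = 1) {P : Fin k → Matrix n n ℂ}
    (hP : ∀ i, (P i).PosDef) : (∑ i, w i • P i).PosDef := by
  obtain ⟨i, hi⟩ : ∃ i, 0 < w i := by
    by_contra! h
    linarith [Finset.sum_nonpos fun i (_ : i ∈ Finset.univ) => h i]
  rw [← Finset.add_sum_erase _ _ (Finset.mem_univ i)]
  exact (posDef_smul (hP i) hi).add_posSemidef
    (posSemidef_sum _ fun j _ => smul_posSemidef (hP j).posSemidef (hw j))

lemma re_trace_weighted_sum_le_one {n : Type*} [Fintype n] {k : ℕ} {w : Fin k → ℝ}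
    (hw : ∀ i, 0 ≤ w i) (hw1 : ∑ i, w i = 1) {P : Fin k → Matrix n n ℂ}
    (hP : ∀ i, (P i).trace.re ≤ 1) : (∑ i, w i • P i).trace.re ≤ 1 := by
  rw [trace_sum, Complex.re_sum, ← hw1]
  refine Finset.sum_le_sum fun i _ => ?_
  rw [trace_smul, Complex.smul_re, smul_eq_mul]
  exact mul_le_of_le_one_right (hw i) (hP i)

/-- The extremal weights in Hölder's inequality. -/
lemma sum_weights_mul_eq {k : ℕ} {d : Fin k → ℝ} (hd : ∀ i, 0 ≤ d i) {r : ℝ} (hr : 0 < r)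
    (hW : 0 < ∑ i, d i ^ r) :
    ∑ i, (d i ^ r / ∑ j, d j ^ r) ^ (1 - 1 / r) * d i = (∑ j, d j ^ r) ^ (1 / r) := by
  set W := ∑ j, d j ^ r
  have h1 : ∀ i, (d i ^ r / W) ^ (1 - 1 / r) * d i = d i ^ r * (W ^ (1 - 1 / r))⁻¹ := fun i => by
    rcases (hd i).eq_or_lt with h | h
    · rw [← h, mul_zero, Real.zero_rpow hr.ne', zero_mul]
    · rw [Real.div_rpow (Real.rpow_nonneg h.le _) hW.le, ← Real.rpow_mul h.le, mul_sub, mul_one,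
        mul_one_div_cancel hr.ne', Real.rpow_sub_one h.ne']
      field_simp
  rw [Finset.sum_congr rfl fun i _ => h1 i, ← Finset.sum_mul, ← Real.rpow_neg hW.le,
    ← Real.rpow_one_add' hW.le (by ring_nf; positivity)]
  ring_nf

variable {q p κ : ℝ}

/-- The space `S_q(S_p)` has cotype `2 / (1 - κ)`. -/
theorem Exponents.cotype (h : Exponents q p κ) (hp2 : p ≤ 2) (hκ : κ ≤ 2 / p - 1) {r : ℝ}
    (hr : 1 / r = (1 - κ) / 2) {N M k : ℕ} (x : Fin k → Matrix (Fin N × Fin M) (Fin N × Fin M) ℂ) :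
    (∑ i, sqSpNorm q p (x i) ^ r) ^ (1 / r) ≤
      4 * coreConst (2 / p - 1) * √(avg fun ε => sqSpNorm q p (rad x ε) ^ 2) := by
  have hp := h.one_le
  have hκ0 := h.nonneg
  have hr0 : 0 < r := by
    rw [← one_div_pos, hr]
    linarith [h.lt_one]
  set θ := 2 / p - 1 with hθ
  have hθ1 : θ ≤ 1 := by
    rw [hθ, sub_le_iff_le_add, div_le_iff₀ (by linarith)]
    linarith
  have hpθ : p * (1 + θ) = 2 := by
    rw [hθ]
    field_simp
    ring
  obtain ⟨s, hs0, hs1, hs⟩ : ∃ s : ℝ, 0 ≤ s ∧ s ≤ 1 ∧ κ = s * θ := by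
    rcases (hκ0.trans hκ).eq_or_lt with h0 | h0
    · exact ⟨0, le_rfl, zero_le_one, by linarith⟩
    · exact ⟨κ / θ, by positivity, (div_le_one h0).2 hκ, (div_mul_cancel₀ _ h0.ne').symm⟩
  choose ρ σ hρ hσ hx using fun i => h.exists_sqSpNorm_le hp2 (x i)
  set d : Fin k → ℝ := fun i => snorm p (mpow (ρ i ⊗ₖ (1 : Matrix (Fin M) (Fin M) ℂ)) (κ / 2) *
    x i * mpow (σ i ⊗ₖ (1 : Matrix (Fin M) (Fin M) ℂ)) (κ / 2)) with hd
  have hd0 : ∀ i, 0 ≤ d i := fun i => snorm_nonneg _ _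
  have hdr : ∀ i, 0 ≤ d i ^ r := fun i => Real.rpow_nonneg (hd0 i) r
  have key : (∑ i, d i ^ r) ^ (1 / r) ≤
      coreConst θ * √(avg fun ε => sqSpNorm q p (rad x ε) ^ 2) := by
    have hC : 0 ≤ coreConst θ := by
      rw [coreConst]
      split_ifs <;> positivity
    rcases (Finset.sum_nonneg fun i (_ : i ∈ Finset.univ) => hdr i).eq_or_lt with hW | hW
    · rw [← hW, Real.zero_rpow (by positivity)]
      positivity
    rw [← sum_weights_mul_eq hd0 hr0 hW]
    set w : Fin k → ℝ := fun i => d i ^ r / ∑ j, d j ^ r with hwd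
    have hw : ∀ i, 0 ≤ w i := fun i => div_nonneg (hdr i) hW.le
    have hw1 : ∑ i, w i = 1 := by rw [← Finset.sum_div, div_self hW.ne']
    have hsum : ∀ τ : Fin k → Matrix (Fin N) (Fin N) ℂ,
        ∑ i, w i • (τ i ⊗ₖ (1 : Matrix (Fin M) (Fin M) ℂ)) =
          (∑ i, w i • τ i) ⊗ₖ (1 : Matrix (Fin M) (Fin M) ℂ) := fun τ => by
      ext ⟨a, b⟩ ⟨c, e⟩
      simp [Matrix.sum_apply, kroneckerMap_apply, Finset.sum_mul, mul_assoc]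
    have hpd : ∀ {τ : Matrix (Fin N) (Fin N) ℂ}, τ.PosDef →
        (τ ⊗ₖ (1 : Matrix (Fin M) (Fin M) ℂ)).PosDef := fun hτ => hτ.kronecker PosDef.one
    have hS := posDef_weighted_sum hw hw1 fun i => (hρ i).1
    have hT := posDef_weighted_sum hw hw1 fun i => (hσ i).1
    have h1 := sum_weighted_snorm_le hw hw1 x (fun i => hpd (hρ i).1) (fun i => hpd (hσ i).1)
      (hpd hS) (hpd hT) (hsum ρ) (hsum σ) hs0 hs1 (hκ0.trans hκ) hθ1 hpθ hs
    rw [show (1 + κ) / 2 = 1 - 1 / r by rw [hr]; ring] at h1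
    refine h1.trans ?_
    gcongr
    refine avg_mono fun ε => ?_
    gcongr
    · exact snorm_nonneg _ _
    · exact h.snorm_le_sqSpNorm hp2 hS
        (re_trace_weighted_sum_le_one hw hw1 fun i => (hρ i).2) hT
        (re_trace_weighted_sum_le_one hw hw1 fun i => (hσ i).2) _
  calc (∑ i, sqSpNorm q p (x i) ^ r) ^ (1 / r) ≤ (∑ i, 4 ^ r * d i ^ r) ^ (1 / r) := by
        have h0 := fun i => h.sqSpNorm_nonneg (x i)
        gcongr with i
        · exact Finset.sum_nonneg fun i _ => Real.rpow_nonneg (h0 i) _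
        · rw [← Real.mul_rpow (by norm_num) (hd0 i)]
          exact Real.rpow_le_rpow (h0 i) (hx i) hr0.le
    _ = 4 * (∑ i, d i ^ r) ^ (1 / r) := by
        rw [← Finset.mul_sum, Real.mul_rpow (by positivity) (Finset.sum_nonneg fun i _ => hdr i),
          ← Real.rpow_mul (by norm_num), mul_one_div_cancel hr0.ne', Real.rpow_one]
    _ ≤ _ := by
        rw [mul_assoc]
        gcongr

end Cotype

section Sharpness

open scoped MatrixOrder

variable {n : Type*} [Fintype n] [DecidableEq n]

lemma mpow_of_idempotent {A : Matrix n n ℂ} (hA : A.IsHermitian) (h : A * A = A) {s : ℝ}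
    (hs : s ≠ 0) : mpow A s = A := by
  have h1 : fc (fun t => t * t) A = fc (fun t => t) A := by
    rw [← fc_mul, fc_id hA, h]
  conv_rhs => rw [← fc_id hA]
  refine fc_congr hA fun i => ?_
  have h2 := le_antisymm (eigenvalues_le_of_fc_le hA h1.le i) (eigenvalues_le_of_fc_le hA h1.ge i)
  rcases (IsIdempotentElem.iff_eq_zero_or_one (p := hA.eigenvalues i)).1 h2 with h3 | h3
  · rw [h3, Real.zero_rpow hs]
  · rw [h3, Real.one_rpow]

omit [Fintype n] in
lemma single_isHermitian (i : n) : (single i i (1 : ℂ)).IsHermitian := by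
  rw [IsHermitian, conjTranspose_single, star_one]

lemma mpow_single (i : n) {s : ℝ} (hs : s ≠ 0) : mpow (single i i (1 : ℂ)) s = single i i 1 :=
  mpow_of_idempotent (single_isHermitian i) (by rw [single_mul_single_same, one_mul]) hs

lemma single_posSemidef (i : n) : (single i i (1 : ℂ)).PosSemidef := by
  have h := posSemidef_conjTranspose_mul_self (single i i (1 : ℂ))
  rwa [(single_isHermitian i).eq, single_mul_single_same, one_mul] at h

lemma snorm_eq_sqrt {p : ℝ} (hp : 0 < p) {X : Matrix n n ℂ} {c : ℝ} (hc : 0 ≤ c) {i : n}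
    (hX : Xᴴ * X = c • single i i (1 : ℂ)) : snorm p X = √c := by
  rw [snorm, hX, mpow_smul (single_posSemidef i) hc, mpow_single i (by positivity),
    re_trace_smul, trace_single_eq_same, Complex.one_re, mul_one, ← Real.rpow_mul hc,
    Real.sqrt_eq_rpow]
  congr 1
  field_simp

variable {q p κ : ℝ}

lemma Exponents.schNorm_single_le_one (h : Exponents q p κ) (i : n) :
    schNorm (multExp q p) (single i i (1 : ℂ)) ≤ 1 := by
  have e : (single i i (1 : ℂ))ᴴ * single i i 1 = single i i 1 := by
    rw [(single_isHermitian i).eq, single_mul_single_same, one_mul]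
  rcases h.nonneg.eq_or_lt with h0 | h0
  · rw [h.multExp_of_eq_zero h0.symm, schNorm_top_le_one_iff, e, Matrix.le_iff]
    have h1 := posSemidef_conjTranspose_mul_self (1 - single i i (1 : ℂ))
    rwa [conjTranspose_sub, conjTranspose_one, (single_isHermitian i).eq, Matrix.sub_mul,
      one_mul, Matrix.mul_sub, mul_one, single_mul_single_same, one_mul, sub_self, sub_zero] at h1
  · rw [h.schNorm_le_one_iff h0, e, mpow_single i (by positivity), trace_single_eq_same,
      Complex.one_re]

lemma Exponents.re_trace_conjTranspose_mul_self_le (h : Exponents q p κ) [Nonempty n]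
    {a : Matrix n n ℂ} (ha : schNorm (multExp q p) a ≤ 1) :
    (aᴴ * a).trace.re ≤ (Fintype.card n : ℝ) ^ (1 - κ) := by
  have hP := posSemidef_conjTranspose_mul_self a
  have hn : (0 : ℝ) < Fintype.card n := by exact_mod_cast Fintype.card_pos
  have htr : (aᴴ * a).trace.re = ∑ j, ctmEig a j := by
    conv_lhs => rw [← fc_id hP.isHermitian, re_trace_fc hP.isHermitian]
    rfl
  rw [htr]
  rcases h.nonneg.eq_or_lt with h0 | h0
  · rw [← h0, sub_zero, Real.rpow_one]
    calc ∑ j, ctmEig a j ≤ ∑ _j : n, (1 : ℝ) :=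
          Finset.sum_le_sum fun j _ => ctmEig_le_one (h.conjTranspose_mul_self_le_one ha) j
      _ = Fintype.card n := by simp
  · rw [h.schNorm_le_one_iff h0, mpow, re_trace_fc hP.isHermitian] at ha
    have h1 : (∑ j, ctmEig a j) ^ (1 / κ) ≤ (Fintype.card n : ℝ) ^ (1 / κ - 1) := by
      have h2 := Real.rpow_sum_le_const_mul_sum_rpow_of_nonneg (p := 1 / κ) Finset.univ
        (by rw [le_div_iff₀ h0]; linarith [h.lt_one]) fun j _ => ctmEig_nonneg a j
      rw [Finset.card_univ] at h2
      exact h2.trans (mul_le_of_le_one_right (by positivity) ha)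
    have h3 := Real.rpow_le_rpow
      (Real.rpow_nonneg (Finset.sum_nonneg fun j _ => ctmEig_nonneg a j) _) h1 h0.le
    rw [← Real.rpow_mul (Finset.sum_nonneg fun j _ => ctmEig_nonneg a j), ← Real.rpow_mul hn.le,
      one_div_mul_cancel h0.ne', Real.rpow_one, sub_mul, one_div_mul_cancel h0.ne', one_mul] at h3
    exact h3

variable {m : ℕ}

/-- The extremal sequence for the cotype of `S_q(S_p)`: it spans a row over the diagonal. -/
def diagUnit (k : Fin (m + 1)) :
    Matrix (Fin (m + 1) × Fin (m + 1)) (Fin (m + 1) × Fin (m + 1)) ℂ :=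
  single (k, k) (0, 0) 1

lemma Exponents.one_le_sqSpNorm_diagUnit (h : Exponents q p κ) (hp2 : p ≤ 2) (k : Fin (m + 1)) :
    1 ≤ sqSpNorm q p (diagUnit k) := by
  have hp := h.one_le
  refine le_csSup (h.bddAbove_normSet hp2 _) ⟨single k k 1, single 0 0 1,
    h.schNorm_single_le_one k, h.schNorm_single_le_one 0, ?_⟩
  have e : single k k (1 : ℂ) ⊗ₖ (1 : Matrix (Fin (m + 1)) (Fin (m + 1)) ℂ) * diagUnit k *
      single 0 0 (1 : ℂ) ⊗ₖ (1 : Matrix (Fin (m + 1)) (Fin (m + 1)) ℂ) = diagUnit k := by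
    have h1 : (diagUnit k : Matrix (Fin (m + 1) × Fin (m + 1)) _ ℂ) =
        single k 0 1 ⊗ₖ single k 0 1 := by
      rw [single_kronecker_single, one_mul, diagUnit]
    rw [h1, ← mul_kronecker_mul, ← mul_kronecker_mul, one_mul, mul_one, single_mul_single_same,
      single_mul_single_same, one_mul, one_mul]
  rw [e, schNorm_ofReal (by linarith), snorm_eq_sqrt (c := 1) (i := (0, 0)) (by linarith)
    zero_le_one, Real.sqrt_one]
  rw [diagUnit, conjTranspose_single, star_one, single_mul_single_same, one_mul, one_smul]

lemma conjTranspose_mul_self_rad_diagUnit (a : Matrix (Fin (m + 1)) (Fin (m + 1)) ℂ)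
    (ε : Fin (m + 1) → Bool) :
    (a ⊗ₖ (1 : Matrix (Fin (m + 1)) (Fin (m + 1)) ℂ) * rad diagUnit ε)ᴴ *
      (a ⊗ₖ (1 : Matrix (Fin (m + 1)) (Fin (m + 1)) ℂ) * rad diagUnit ε) =
      (aᴴ * a).trace.re • single (0, 0) (0, 0) (1 : ℂ) := by
  have h1 : ∀ k l : Fin (m + 1), (diagUnit k)ᴴ * ((aᴴ * a) ⊗ₖ
      (1 : Matrix (Fin (m + 1)) (Fin (m + 1)) ℂ) * diagUnit l) =
      ((aᴴ * a) k l * (1 : Matrix (Fin (m + 1)) (Fin (m + 1)) ℂ) k l) •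
        single (0, 0) (0, 0) (1 : ℂ) := fun k l => by
    rw [diagUnit, diagUnit, conjTranspose_single, star_one, ← Matrix.mul_assoc,
      single_mul_mul_single, kroneckerMap_apply, one_mul, mul_one, smul_single, smul_eq_mul,
      mul_one]
  have h2 : ((aᴴ * a).trace.re : ℂ) = (aᴴ * a).trace :=
    Complex.conj_eq_iff_re.1 (by
      rw [starRingEnd_apply, ← trace_conjTranspose, (isHermitian_conjTranspose_mul_self a).eq])
  rw [conjTranspose_mul, Matrix.mul_assoc, ← Matrix.mul_assoc _ _ (rad diagUnit ε),
    kronecker_one_conjTranspose_mul, ← Complex.coe_smul, h2, rad, conjTranspose_sum,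
    Finset.sum_mul, trace, Finset.sum_smul]
  refine Finset.sum_congr rfl fun k _ => ?_
  rw [Finset.mul_sum, Finset.mul_sum, Finset.sum_eq_single k]
  · rw [conjTranspose_smul, star_trivial, Matrix.mul_smul, Matrix.mul_smul, Matrix.smul_mul,
      smul_smul, sgn_mul_self, one_smul, h1, one_apply_eq, mul_one, diag_apply]
  · intro l _ hl
    rw [conjTranspose_smul, star_trivial, Matrix.mul_smul, Matrix.mul_smul, Matrix.smul_mul, h1,
      one_apply_ne hl.symm, mul_zero, zero_smul, smul_zero, smul_zero]
  · exact fun hk => absurd (Finset.mem_univ k) hk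

lemma Exponents.sqSpNorm_rad_diagUnit_le (h : Exponents q p κ) (hp2 : p ≤ 2)
    (ε : Fin (m + 1) → Bool) :
    sqSpNorm q p (rad diagUnit ε) ≤ ((m : ℝ) + 1) ^ ((1 - κ) / 2) := by
  have hp := h.one_le
  rw [sqSpNorm_eq]
  refine Real.sSup_le ?_ (by positivity)
  rintro _ ⟨a, b, ha, hb, rfl⟩
  have h1 := snorm_mono (p := p) (by linarith) hp2 (x := rad diagUnit ε)
    (le_refl ((a ⊗ₖ (1 : Matrix (Fin (m + 1)) (Fin (m + 1)) ℂ))ᴴ *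
      (a ⊗ₖ (1 : Matrix (Fin (m + 1)) (Fin (m + 1)) ℂ))))
    (b := b ⊗ₖ (1 : Matrix (Fin (m + 1)) (Fin (m + 1)) ℂ)) (d := 1)
    (by
      rw [kronecker_one_mul_conjTranspose, conjTranspose_one, one_mul]
      exact (kronecker_one_le (mul_conjTranspose_le_one
        (h.conjTranspose_mul_self_le_one hb))).trans (one_kronecker_one (α := ℂ)).le)
  have h0 : 0 ≤ (aᴴ * a).trace.re := by
    have := re_trace_mpow_nonneg (posSemidef_conjTranspose_mul_self a) 1
    rwa [mpow_one (isHermitian_conjTranspose_mul_self a)] at this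
  rw [mul_one, snorm_eq_sqrt (by linarith) h0 (conjTranspose_mul_self_rad_diagUnit a ε)] at h1
  rw [schNorm_ofReal (by linarith)]
  refine h1.trans ?_
  have h2 := h.re_trace_conjTranspose_mul_self_le ha
  rw [Fintype.card_fin, Nat.cast_succ] at h2
  rw [div_eq_mul_one_div, Real.rpow_mul (by positivity), ← Real.sqrt_eq_rpow]
  exact Real.sqrt_le_sqrt h2

lemma not_forall_rpow_le {s t : ℝ} (hst : s < t) (C : ℝ) :
    ¬ ∀ m : ℕ, ((m : ℝ) + 1) ^ t ≤ C * ((m : ℝ) + 1) ^ s := fun h => by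
  have h1 : Filter.Tendsto (fun m : ℕ => ((m : ℝ) + 1) ^ (t - s)) Filter.atTop Filter.atTop :=
    (tendsto_rpow_atTop (sub_pos.2 hst)).comp
      (Filter.tendsto_atTop_add_const_right _ _ tendsto_natCast_atTop_atTop)
  obtain ⟨m, hm⟩ := (h1.eventually_gt_atTop C).exists
  rw [Real.rpow_sub (by positivity), lt_div_iff₀ (by positivity)] at hm
  exact (h m).not_gt hm

/-- The space `S_q(S_p)` fails cotype `s` for `s < 2 / (1 - κ)`. -/
theorem Exponents.not_cotype (h : Exponents q p κ) (hp2 : p ≤ 2) {s : ℝ} (hs : 1 ≤ s)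
    (hsκ : (1 - κ) / 2 < 1 / s) (C : ℝ) :
    ¬ ∀ (N M k : ℕ) (x : Fin k → Matrix (Fin N × Fin M) (Fin N × Fin M) ℂ),
      (∑ i, sqSpNorm q p (x i) ^ s) ^ (1 / s) ≤
        C * √(avg fun ε => sqSpNorm q p (rad x ε) ^ 2) := fun hC => by
  refine not_forall_rpow_le hsκ |C| fun m => ?_
  calc ((m : ℝ) + 1) ^ (1 / s)
      ≤ (∑ i : Fin (m + 1), sqSpNorm q p (diagUnit i) ^ s) ^ (1 / s) := by
        gcongr
        calc (m : ℝ) + 1 = ∑ _i : Fin (m + 1), (1 : ℝ) := by simp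
          _ ≤ _ := Finset.sum_le_sum fun i _ =>
            Real.one_le_rpow (h.one_le_sqSpNorm_diagUnit hp2 i) (by linarith)
    _ ≤ C * √(avg fun ε => sqSpNorm q p (rad (diagUnit (m := m)) ε) ^ 2) := hC _ _ _ _
    _ ≤ |C| * √(avg fun _ : Fin (m + 1) → Bool => (((m : ℝ) + 1) ^ ((1 - κ) / 2)) ^ 2) := by
        gcongr
        · exact le_abs_self C
        · refine avg_mono fun ε => ?_
          gcongr
          · exact h.sqSpNorm_nonneg _
          · exact h.sqSpNorm_rad_diagUnit_le hp2 ε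
    _ = |C| * ((m : ℝ) + 1) ^ ((1 - κ) / 2) := by
        rw [avg_const, Real.sqrt_sq (by positivity)]

end Sharpness

lemma sqrt_avg_rad_eq {V : Type*} [AddCommGroup V] [Module ℂ V] {k : ℕ} (f : V → ℝ)
    (x : Fin k → V) :
    ((∑ ε : Fin k → Bool, f (∑ i, (if ε i then (1 : ℂ) else -1) • x i) ^ 2) / 2 ^ k) ^
      (1 / 2 : ℝ) = √(avg fun ε => f (∑ i, sgn (ε i) • x i) ^ 2) := by
  rw [← Real.sqrt_eq_rpow, avg, smul_eq_mul, inv_mul_eq_div]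
  have h : ∀ b, (if b then (1 : ℂ) else -1) = (sgn b : ℂ) := fun b => by cases b <;> simp [sgn]
  simp only [h, Complex.coe_smul]

end SchattenCotype

/-- For `1 ≤ p ≤ 2`, `p ≤ q ≤ p'` and `1/r = (1 - 1/p + 1/q)/2`, the Banach space
`S_q(S_p)` has Rademacher cotype `r`, and this is sharp: it fails cotype `s` for all
`s < r`. -/
theorem stmt_7 (p q r : ℝ) (hp : 1 ≤ p) (hp2 : p ≤ 2) (hpq : p ≤ q) (hqp' : 1 - 1/p ≤ 1/q)
    (hr : 1/r = (1 - 1/p + 1/q) / 2) :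
    (∃ C : ℝ, ∀ (N M n : ℕ) (x : Fin n → Matrix (Fin N × Fin M) (Fin N × Fin M) ℂ),
      (∑ k, sqSpNorm q p (x k) ^ r) ^ (1/r) ≤
        C * ((∑ ε : Fin n → Bool,
            sqSpNorm q p (∑ k, (if ε k then (1 : ℂ) else -1) • x k) ^ 2) / 2 ^ n) ^ (1/2 : ℝ)) ∧
    (∀ s : ℝ, 1 ≤ s → s < r →
      ¬ ∃ C : ℝ, ∀ (N M n : ℕ) (x : Fin n → Matrix (Fin N × Fin M) (Fin N × Fin M) ℂ),
        (∑ k, sqSpNorm q p (x k) ^ s) ^ (1/s) ≤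
          C * ((∑ ε : Fin n → Bool,
              sqSpNorm q p (∑ k, (if ε k then (1 : ℂ) else -1) • x k) ^ 2) / 2 ^ n) ^ (1/2 : ℝ)) := by
  have h : SchattenCotype.Exponents q p (1 / p - 1 / q) := ⟨hp, hpq, rfl⟩
  have hr' : 1 / r = (1 - (1 / p - 1 / q)) / 2 := by
    rw [hr]
    ring
  have hκ : 1 / p - 1 / q ≤ 2 / p - 1 := by
    have : 2 / p = 1 / p + 1 / p := by ring
    linarith
  simp only [SchattenCotype.sqrt_avg_rad_eq]
  refine ⟨⟨_, fun N M n x => h.cotype hp2 hκ hr' x⟩, fun s hs hsr => ?_⟩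
  rintro ⟨C, hC⟩
  refine h.not_cotype hp2 hs ?_ C hC
  rw [← hr']
  exact one_div_lt_one_div_of_lt (by linarith) hsr
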